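/- Let α > 0 be a real number. Then as x → ∞, Σ_{√x < p ≤ √x (log x)^{4/α}, p prime} p^{-α} Σ_{q ≤ x/p, q prime} q^{α} = (2/(α(α+1)))·x/(log x)^2 + (4/(α(α+1)²))·x/(log x)^3 + O(x/(log x)^4). -/

import Mathlib

open Filter Finset

/-- The entire function `(s - 1) ζ(s)`. -/
noncomputable def zetaReg : ℂ → ℂ := Function.update (fun s => (s - 1) * riemannZeta s) 1 1

theorem zetaReg_of_ne_one {s : ℂ} (hs : s ≠ 1) : zetaReg s = (s - 1) * riemannZeta s := by
  simp [zetaReg, hs]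

theorem zetaReg_one : zetaReg 1 = 1 := by simp [zetaReg]

theorem differentiable_zetaReg : Differentiable ℂ zetaReg := by
  intro s
  have key : ∀ s : ℂ, s ≠ 1 → DifferentiableAt ℂ zetaReg s := by
    intro s hs
    have h1 : DifferentiableAt ℂ (fun s => (s - 1) * riemannZeta s) s :=
      (differentiableAt_id.sub_const 1).mul (differentiableAt_riemannZeta hs)
    refine h1.congr_of_eventuallyEq ?_
    filter_upwards [eventually_ne_nhds hs] with t ht using zetaReg_of_ne_one ht
  rcases eq_or_ne s 1 with rfl | hs
  · refine (Complex.analyticAt_of_differentiable_on_punctured_nhds_of_continuousAt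
      ?_ ?_).differentiableAt
    · filter_upwards [self_mem_nhdsWithin] with t ht using key t ht
    · exact continuousAt_update_same.mpr riemannZeta_residue_one
  · exact key s hs

theorem zetaReg_ne_zero {s : ℂ} (hs : 1 ≤ s.re) : zetaReg s ≠ 0 := by
  rcases eq_or_ne s 1 with rfl | h
  · simp [zetaReg_one]
  · rw [zetaReg_of_ne_one h]
    exact mul_ne_zero (sub_ne_zero.mpr h) (riemannZeta_ne_zero_of_one_le_re hs)

/-- The terms of a series for `(s - 1) ζ(s) - 1` that converges for `0 < re s`. -/
noncomputable def zetaTerm (n : ℕ) (s : ℂ) : ℂ :=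
  (s - 1) * (n + 1 : ℂ) ^ (-s) + ((n + 2 : ℂ) ^ (1 - s) - (n + 1 : ℂ) ^ (1 - s))

theorem differentiable_zetaTerm (n : ℕ) : Differentiable ℂ (zetaTerm n) := by
  have h1 : (n + 1 : ℂ) ≠ 0 := by exact_mod_cast n.succ_ne_zero
  have h2 : (n + 2 : ℂ) ≠ 0 := by exact_mod_cast (n + 1).succ_ne_zero
  unfold zetaTerm
  intro s
  have e1 : DifferentiableAt ℂ (fun s : ℂ => (n + 1 : ℂ) ^ (-s)) s :=
    (differentiableAt_id.neg).const_cpow (Or.inl h1)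
  have e2 : DifferentiableAt ℂ (fun s : ℂ => (n + 2 : ℂ) ^ (1 - s)) s :=
    (differentiableAt_id.const_sub 1).const_cpow (Or.inl h2)
  have e3 : DifferentiableAt ℂ (fun s : ℂ => (n + 1 : ℂ) ^ (1 - s)) s :=
    (differentiableAt_id.const_sub 1).const_cpow (Or.inl h1)
  exact ((differentiableAt_id.sub_const 1).mul e1).add (e2.sub e3)

theorem norm_cpow_neg_sub_le {a x : ℝ} (ha : 0 < a) (hx : a ≤ x) (hx1 : x ≤ a + 1) {s : ℂ}
    (hs : 0 < s.re) :
    ‖(x : ℂ) ^ (-s) - (a : ℂ) ^ (-s)‖ ≤ ‖s‖ * a ^ (-s.re - 1) := by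
  have h := norm_image_sub_le_of_norm_deriv_le_segment' (f := fun y : ℝ => (y : ℂ) ^ (-s))
    (f' := fun y : ℝ => (-s) * (y : ℂ) ^ (-s - 1)) (a := a) (b := x)
    (C := ‖s‖ * a ^ (-s.re - 1)) ?_ ?_ x ⟨hx, le_rfl⟩
  · refine h.trans (mul_le_of_le_one_right (by positivity) (by linarith))
  · intro y hy
    refine (hasDerivAt_ofReal_cpow_const (by linarith [hy.1]) ?_).hasDerivWithinAt
    intro h0
    simp [neg_eq_zero.mp h0] at hs
  · intro y hy
    have hy0 : 0 < y := ha.trans_le hy.1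
    rw [norm_mul, norm_neg, Complex.norm_cpow_eq_rpow_re_of_pos hy0]
    gcongr
    simp only [Complex.sub_re, Complex.neg_re, Complex.one_re]
    exact Real.rpow_le_rpow_of_nonpos ha hy.1 (by linarith)

theorem norm_cpow_neg_sub_le' {a x : ℝ} (ha : 0 < a) (hx : a ≤ x) {s : ℂ}
    (hs : 0 < s.re) :
    ‖(x : ℂ) ^ (-s) - (a : ℂ) ^ (-s)‖ ≤ 2 * a ^ (-s.re) := by
  refine (norm_sub_le _ _).trans ?_
  rw [Complex.norm_cpow_eq_rpow_re_of_pos ha, Complex.norm_cpow_eq_rpow_re_of_pos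
    (ha.trans_le hx)]
  have := Real.rpow_le_rpow_of_nonpos ha hx (show (-s).re ≤ 0 by simp [hs.le])
  simp only [Complex.neg_re] at *
  linarith

theorem norm_zetaTerm_le_of_forall {n : ℕ} {s : ℂ} {C : ℝ} (hs : s ≠ 1)
    (hC : ∀ x : ℝ, (n + 1 : ℝ) ≤ x → x ≤ n + 1 + 1 →
      ‖(x : ℂ) ^ (-s) - ((n + 1 : ℝ) : ℂ) ^ (-s)‖ ≤ C) :
    ‖zetaTerm n s‖ ≤ ‖s - 1‖ * C := by
  have h := norm_image_sub_le_of_norm_deriv_le_segment'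
    (f := fun y : ℝ => (y : ℂ) ^ (1 - s) - (1 - s) * ((n + 1 : ℝ) : ℂ) ^ (-s) * y)
    (f' := fun y : ℝ => (1 - s) * (y : ℂ) ^ (1 - s - 1)
      - (1 - s) * ((n + 1 : ℝ) : ℂ) ^ (-s) * 1) (a := (n + 1 : ℝ)) (b := n + 1 + 1)
    (C := ‖s - 1‖ * C) ?_ ?_ (n + 1 + 1) ⟨by linarith, le_rfl⟩
  · rw [add_sub_cancel_left, mul_one] at h
    refine le_of_eq_of_le (congrArg norm ?_) h
    unfold zetaTerm
    push_cast
    rw [show (n + 1 + 1 : ℂ) = n + 2 by ring]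
    ring
  · intro y hy
    refine HasDerivAt.hasDerivWithinAt (HasDerivAt.sub
      (hasDerivAt_ofReal_cpow_const (by linarith [hy.1, (Nat.cast_nonneg n : (0 : ℝ) ≤ n)]) (sub_ne_zero.mpr hs.symm)) ?_)
    exact (Complex.ofRealCLM.hasDerivAt (x := y)).const_mul _
  · intro y hy
    rw [mul_one, ← mul_sub, norm_mul, norm_sub_rev, show (1 - s - 1 : ℂ) = -s by ring]
    gcongr
    exact hC y hy.1 hy.2.le

theorem min_le_rpow_mul_rpow {a b θ : ℝ} (ha : 0 ≤ a) (hb : 0 ≤ b) (h0 : 0 ≤ θ) (h1 : θ ≤ 1) :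
    min a b ≤ a ^ θ * b ^ (1 - θ) := by
  have hm : 0 ≤ min a b := le_min ha hb
  calc min a b = min a b ^ θ * min a b ^ (1 - θ) := by
        rw [← Real.rpow_add' hm (by simp)]; simp
    _ ≤ _ := by
        gcongr
        · exact min_le_left _ _
        · exact min_le_right _ _

theorem norm_zetaTerm_le {e : ℝ} (he : 0 < e) (he1 : e ≤ 1 / 4) (n : ℕ) {s : ℂ}
    (hs : 1 - e ≤ s.re) :
    ‖zetaTerm n s‖ ≤ ‖s - 1‖ * (2 * ‖s‖ ^ (2 * e) * (n + 1 : ℝ) ^ (-1 - e)) := by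
  rcases eq_or_ne s 1 with rfl | h1
  · simp [zetaTerm]
  have hs0 : 0 < s.re := by linarith
  have hn : (0 : ℝ) < n + 1 := by positivity
  have hn1 : (1 : ℝ) ≤ n + 1 := by linarith [(Nat.cast_nonneg n : (0 : ℝ) ≤ n)]
  refine norm_zetaTerm_le_of_forall h1 fun x hx hx1 => ?_
  refine (le_min (norm_cpow_neg_sub_le hn hx hx1 hs0) (norm_cpow_neg_sub_le' hn hx hs0)).trans ?_
  refine (min_le_rpow_mul_rpow (θ := 2 * e) (by positivity) (by positivity) (by linarith)
    (by linarith)).trans ?_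
  rw [Real.mul_rpow (by positivity) (by positivity), Real.mul_rpow (by positivity) (by positivity),
    ← Real.rpow_mul hn.le, ← Real.rpow_mul hn.le]
  have h2 : (2 : ℝ) ^ (1 - 2 * e) ≤ 2 := by
    conv_rhs => rw [← Real.rpow_one 2]
    exact Real.rpow_le_rpow_of_exponent_le (by norm_num) (by linarith)
  have h3 : (n + 1 : ℝ) ^ ((-s.re - 1) * (2 * e)) * (n + 1 : ℝ) ^ (-s.re * (1 - 2 * e))
      ≤ (n + 1 : ℝ) ^ (-1 - e) := by
    rw [← Real.rpow_add hn]
    exact Real.rpow_le_rpow_of_exponent_le hn1 (by nlinarith)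
  calc _ = ‖s‖ ^ (2 * e) * 2 ^ (1 - 2 * e) * ((n + 1 : ℝ) ^ ((-s.re - 1) * (2 * e)) *
        (n + 1 : ℝ) ^ (-s.re * (1 - 2 * e))) := by ring
    _ ≤ ‖s‖ ^ (2 * e) * 2 * (n + 1 : ℝ) ^ (-1 - e) := by gcongr
    _ = _ := by ring

theorem summable_nat_add_one_rpow {e : ℝ} (he : 0 < e) :
    Summable fun n : ℕ => (n + 1 : ℝ) ^ (-1 - e) := by
  have h := (summable_nat_add_iff 1).mpr (Real.summable_nat_rpow.mpr (show -1 - e < -1 by linarith))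
  simpa using h

theorem summable_zetaTerm {e : ℝ} (he : 0 < e) (he1 : e ≤ 1 / 4) {s : ℂ} (hs : 1 - e ≤ s.re) :
    Summable fun n => zetaTerm n s :=
  Summable.of_norm_bounded (((summable_nat_add_one_rpow he).mul_left _).mul_left _)
    fun n => norm_zetaTerm_le he he1 n hs

theorem zetaReg_eq_of_one_lt_re {s : ℂ} (hs : 1 < s.re) :
    zetaReg s = 1 + ∑' n, zetaTerm n s := by
  have hs1 : s ≠ 1 := by rintro rfl; simp at hs
  have hz : Summable fun n : ℕ => (n + 1 : ℂ) ^ (-s) := by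
    have := (summable_nat_add_iff 1).mpr (Complex.summable_one_div_nat_cpow.mpr hs)
    refine this.congr fun n => ?_
    rw [Complex.cpow_neg, one_div]; norm_cast
  have ht := ((summable_zetaTerm (e := 1 / 4) (by norm_num) (by norm_num)
    (by linarith)).hasSum (f := fun n => zetaTerm n s)).tendsto_sum_nat
  have ht2 := (hz.mul_left (s - 1)).hasSum.tendsto_sum_nat
  have ht3 : Tendsto (fun N : ℕ => (N + 1 : ℂ) ^ (1 - s) - 1) atTop (nhds (0 - 1)) := by
    refine Tendsto.sub_const ?_ 1
    rw [tendsto_zero_iff_norm_tendsto_zero]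
    have h4 : Tendsto (fun N : ℕ => ((N : ℝ) + 1) ^ (-(s.re - 1))) atTop (nhds 0) :=
      (tendsto_rpow_neg_atTop (show 0 < s.re - 1 by linarith)).comp
        (tendsto_atTop_add_const_right _ 1 tendsto_natCast_atTop_atTop)
    refine h4.congr fun N => ?_
    have := Complex.norm_cpow_eq_rpow_re_of_pos (show (0 : ℝ) < N + 1 by positivity) (1 - s)
    push_cast at this
    rw [this]
    simp
  have h5 := tendsto_nhds_unique ht (((ht2.add ht3)).congr fun N => ?_)
  · rw [zetaReg_of_ne_one hs1, h5, zeta_eq_tsum_one_div_nat_add_one_cpow hs, tsum_mul_left]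
    simp only [Complex.cpow_neg, one_div]
    ring
  · simp only [zetaTerm, sum_add_distrib, add_right_inj]
    have := sum_range_sub (fun n : ℕ => (n + 1 : ℂ) ^ (1 - s)) N
    push_cast at this
    simp only [zero_add, Complex.one_cpow, add_assoc, one_add_one_eq_two] at this ⊢
    rw [this]

theorem zetaReg_eq {e : ℝ} (he : 0 < e) (he1 : e ≤ 1 / 4) {s : ℂ} (hs : 1 - e < s.re) :
    zetaReg s = 1 + ∑' n, zetaTerm n s := by
  set R : ℝ := ‖s‖ + 3 with hR
  set Ω : Set ℂ := {z | 1 - e < z.re} ∩ Metric.ball 0 R with hΩ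
  have hopen : IsOpen Ω := (isOpen_lt continuous_const Complex.continuous_re).inter
    Metric.isOpen_ball
  have hconv : Convex ℝ Ω := (convex_halfSpace_re_gt _).inter (convex_ball _ _)
  have hd : DifferentiableOn ℂ (fun z => ∑' n, zetaTerm n z) Ω := by
    refine Complex.differentiableOn_tsum_of_summable_norm
      (u := fun n => (R + 1) * (2 * R ^ (2 * e) * (n + 1 : ℝ) ^ (-1 - e)))
      (((summable_nat_add_one_rpow he).mul_left _).mul_left _)
      (fun n => (differentiable_zetaTerm n).differentiableOn) hopen ?_
    intro n z hz
    have hzR : ‖z‖ ≤ R := by simpa using (Metric.mem_ball.mp hz.2).le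
    refine (norm_zetaTerm_le he he1 n hz.1.le).trans ?_
    have : ‖z - 1‖ ≤ R + 1 := (norm_sub_le _ _).trans (by simpa using hzR)
    gcongr
  have hs2 : (2 : ℂ) ∈ Ω := ⟨by simp; linarith, by
    simp only [hR, Metric.mem_ball, dist_zero_right, Complex.norm_ofNat]
    linarith [norm_nonneg s]⟩
  refine AnalyticOnNhd.eqOn_of_preconnected_of_eventuallyEq
    (differentiable_zetaReg.differentiableOn.analyticOnNhd hopen)
    ((hd.const_add 1).analyticOnNhd hopen) hconv.isPreconnected hs2 ?_ ⟨hs, by simp [hR]⟩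
  filter_upwards [(isOpen_lt continuous_const Complex.continuous_re).mem_nhds
    (show (1 : ℝ) < (2 : ℂ).re by norm_num)] with z hz using zetaReg_eq_of_one_lt_re hz

/-- Polynomial growth of `ζ` with a small exponent, slightly to the left of `re s = 1`. -/
theorem exists_norm_riemannZeta_le {e : ℝ} (he : 0 < e) (he1 : e ≤ 1 / 4) :
    ∃ C : ℝ, 0 < C ∧ ∀ s : ℂ, 1 - e < s.re → s ≠ 1 →
      ‖riemannZeta s‖ ≤ 1 / ‖s - 1‖ + C * ‖s‖ ^ (2 * e) := by
  refine ⟨2 * ∑' n : ℕ, (n + 1 : ℝ) ^ (-1 - e), ?_, ?_⟩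
  · have := (summable_nat_add_one_rpow he).tsum_pos (fun n => by positivity) 0 (by simp)
    linarith
  · intro s hs hs1
    have hpos : 0 < ‖s - 1‖ := norm_pos_iff.mpr (sub_ne_zero.mpr hs1)
    have h1 : ‖∑' n, zetaTerm n s‖ ≤
        ∑' n : ℕ, ‖s - 1‖ * (2 * ‖s‖ ^ (2 * e) * (n + 1 : ℝ) ^ (-1 - e)) :=
      tsum_of_norm_bounded (((summable_nat_add_one_rpow he).mul_left _).mul_left _).hasSum
        fun n => norm_zetaTerm_le he he1 n hs.le
    rw [tsum_mul_left, tsum_mul_left] at h1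
    have h2 : ‖s - 1‖ * ‖riemannZeta s‖ = ‖1 + ∑' n, zetaTerm n s‖ := by
      rw [← norm_mul, ← zetaReg_of_ne_one hs1, zetaReg_eq he he1 hs]
    have h3 := norm_add_le (1 : ℂ) (∑' n, zetaTerm n s)
    rw [← h2, norm_one] at h3
    rw [← mul_le_mul_iff_right₀ hpos, mul_add, mul_one_div_cancel hpos.ne']
    linarith

theorem riemannZeta_product_ge_one {x : ℝ} (hx : 0 < x) (y : ℝ) :
    1 ≤ ‖riemannZeta (1 + x)‖ ^ 3 * ‖riemannZeta (1 + x + Complex.I * y)‖ ^ 4 *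
      ‖riemannZeta (1 + x + 2 * Complex.I * y)‖ := by
  have h := DirichletCharacter.norm_LFunction_product_ge_one (1 : DirichletCharacter ℂ 1) hx y
  simpa [DirichletCharacter.LFunctionTrivChar, DirichletCharacter.LFunction_modOne_eq] using h

theorem exists_norm_riemannZeta_le_abs_im :
    ∃ A : ℝ, 1 ≤ A ∧ ∀ s : ℂ, 99 / 100 < s.re → s.re ≤ 3 → 1 ≤ |s.im| →
      ‖riemannZeta s‖ ≤ A * |s.im| ^ (1 / 50 : ℝ) := by
  obtain ⟨C, hC, h⟩ := exists_norm_riemannZeta_le (e := 1 / 100) (by norm_num) (by norm_num)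
  refine ⟨1 + C * 4, by linarith, fun s hs hs3 ht => ?_⟩
  have hs1 : s ≠ 1 := by
    rintro rfl
    norm_num at ht
  have ht0 : 0 < |s.im| := by linarith
  have h1 := h s (by linarith) hs1
  have h2 : 1 / ‖s - 1‖ ≤ 1 := by
    rw [div_le_one (norm_pos_iff.mpr (sub_ne_zero.mpr hs1))]
    have := Complex.abs_im_le_norm (s - 1)
    simp only [Complex.sub_im, Complex.one_im, sub_zero] at this
    linarith
  have h3 : ‖s‖ ≤ 4 * |s.im| := by
    have := Complex.norm_le_abs_re_add_abs_im s
    rw [abs_of_pos (show 0 < s.re by linarith)] at this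
    linarith
  have h4 : ‖s‖ ^ (2 * (1 / 100) : ℝ) ≤ 4 * |s.im| ^ (1 / 50 : ℝ) := by
    rw [show (2 * (1 / 100) : ℝ) = 1 / 50 by norm_num]
    calc ‖s‖ ^ (1 / 50 : ℝ) ≤ (4 * |s.im|) ^ (1 / 50 : ℝ) := by gcongr
      _ = 4 ^ (1 / 50 : ℝ) * |s.im| ^ (1 / 50 : ℝ) := Real.mul_rpow (by norm_num) (abs_nonneg _)
      _ ≤ _ := by
          gcongr
          conv_rhs => rw [← Real.rpow_one 4]
          exact Real.rpow_le_rpow_of_exponent_le (by norm_num) (by norm_num)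
  have h5 : 1 ≤ |s.im| ^ (1 / 50 : ℝ) := Real.one_le_rpow ht (by norm_num)
  nlinarith

theorem abs_im_le_of_mem_closedBall {s z : ℂ} {r : ℝ} (hz : ‖z - s‖ ≤ r) :
    |s.re - z.re| ≤ r ∧ |s.im| - r ≤ |z.im| ∧ |z.im| ≤ |s.im| + r := by
  have h1 := (Complex.abs_re_le_norm (z - s)).trans hz
  have h2 := (Complex.abs_im_le_norm (z - s)).trans hz
  rw [Complex.sub_re, abs_sub_comm] at h1
  rw [Complex.sub_im] at h2
  have h3 := abs_sub_abs_le_abs_sub z.im s.im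
  have h4 := abs_sub_abs_le_abs_sub s.im z.im
  rw [abs_sub_comm] at h4
  exact ⟨h1, by linarith, by linarith⟩

theorem two_mul_rpow_le {t k : ℝ} (ht : 0 ≤ t) (hk : k ≤ 1) :
    (2 * t) ^ k ≤ 2 * t ^ k := by
  rw [Real.mul_rpow (by norm_num) ht]
  gcongr
  conv_rhs => rw [← Real.rpow_one 2]
  exact Real.rpow_le_rpow_of_exponent_le (by norm_num) hk

theorem exists_norm_deriv_riemannZeta_le :
    ∃ A : ℝ, 1 ≤ A ∧ ∀ s : ℂ, 199 / 200 ≤ s.re → s.re ≤ 2 → 2 ≤ |s.im| →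
      ‖deriv riemannZeta s‖ ≤ A * |s.im| ^ (1 / 50 : ℝ) := by
  obtain ⟨A, hA, h⟩ := exists_norm_riemannZeta_le_abs_im
  refine ⟨A * 2 / (1 / 400), by linarith, fun s hs hs2 ht => ?_⟩
  have key : ∀ z : ℂ, ‖z - s‖ ≤ 1 / 400 →
      z ≠ 1 ∧ ‖riemannZeta z‖ ≤ A * 2 * |s.im| ^ (1 / 50 : ℝ) := by
    intro z hz
    obtain ⟨h1, h2, h3⟩ := abs_im_le_of_mem_closedBall hz
    rw [abs_le] at h1
    refine ⟨?_, (h z (by linarith) (by linarith) (by linarith)).trans ?_⟩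
    · rintro rfl
      norm_num at h2
      linarith
    · rw [mul_assoc]
      gcongr
      refine le_trans ?_ (two_mul_rpow_le (abs_nonneg s.im) (by norm_num))
      gcongr
      linarith
  have hd : DiffContOnCl ℂ riemannZeta (Metric.ball s (1 / 400)) := by
    refine DifferentiableOn.diffContOnCl ?_
    rw [closure_ball _ (by norm_num)]
    intro z hz
    exact (differentiableAt_riemannZeta
      (key z (by simpa [dist_eq_norm] using Metric.mem_closedBall.mp hz)).1).differentiableWithinAt
  refine (Complex.norm_deriv_le_of_forall_mem_sphere_norm_le (by norm_num) hd fun z hz =>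
    (key z (by simpa [dist_eq_norm] using (Metric.mem_sphere.mp hz).le)).2).trans (le_of_eq ?_)
  ring

/-- A zero-free region to the left of `re s = 1`, with a bound for `ζ'/ζ` there. -/
theorem exists_zeroFree :
    ∃ c : ℝ, 0 < c ∧ c ≤ 1 / 200 ∧ ∀ s : ℂ, 1 - c * |s.im| ^ (-(1 / 10) : ℝ) ≤ s.re →
      s.re ≤ 2 → 2 ≤ |s.im| → riemannZeta s ≠ 0 ∧
        ‖deriv riemannZeta s / riemannZeta s‖ ≤ 1 / (2 * (c * |s.im| ^ (-(1 / 10) : ℝ))) := by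
  obtain ⟨A, hA, hup⟩ := exists_norm_riemannZeta_le_abs_im
  obtain ⟨A₁, hA₁, hder⟩ := exists_norm_deriv_riemannZeta_le
  obtain ⟨C, hC, hC'⟩ := exists_norm_riemannZeta_le (e := 1 / 100) (by norm_num) (by norm_num)
  set A₂ : ℝ := 1 + C * 2 with hA₂
  set A₃ : ℝ := A₂ ^ 3 * (A * 2) with hA₃
  have hA₂1 : 1 ≤ A₂ := by linarith
  have hA₃1 : 1 ≤ A₃ := one_le_mul_of_one_le_of_one_le (one_le_pow₀ hA₂1) (by linarith)
  -- lower bound to the right of the line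
  have hlow : ∀ η : ℝ, 0 < η → η ≤ 1 → ∀ t : ℝ, 2 ≤ |t| →
      η ^ 3 ≤ A₃ * |t| ^ (1 / 50 : ℝ) * ‖riemannZeta (1 + η + Complex.I * t)‖ ^ 4 := by
    intro η hη hη1 t ht
    have h1 := riemannZeta_product_ge_one hη t
    have h2 : ‖riemannZeta (1 + η)‖ ≤ A₂ / η := by
      refine (hC' (1 + η) (by simp; linarith) (by simpa using hη.ne')).trans ?_
      have e1 : ‖(1 + η : ℂ) - 1‖ = η := by simp [abs_of_pos hη]
      have e2 : ‖(1 + η : ℂ)‖ = 1 + η := by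
        rw [← Complex.ofReal_one, ← Complex.ofReal_add, Complex.norm_of_nonneg (by linarith)]
      rw [e1, e2, hA₂, add_div]
      gcongr
      rw [le_div_iff₀ hη]
      have e3 : (1 + η) ^ (2 * (1 / 100) : ℝ) ≤ 2 := by
        calc (1 + η) ^ (2 * (1 / 100) : ℝ) ≤ (1 + η) ^ (1 : ℝ) :=
              Real.rpow_le_rpow_of_exponent_le (by linarith) (by norm_num)
          _ ≤ 2 := by rw [Real.rpow_one]; linarith
      calc C * (1 + η) ^ (2 * (1 / 100) : ℝ) * η ≤ C * 2 * 1 := by gcongr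
        _ = C * 2 := by ring
    have h3 : ‖riemannZeta (1 + η + 2 * Complex.I * t)‖ ≤ A * 2 * |t| ^ (1 / 50 : ℝ) := by
      have him : (1 + η + 2 * Complex.I * t : ℂ).im = 2 * t := by simp
      have hre : (1 + η + 2 * Complex.I * t : ℂ).re = 1 + η := by simp
      have := hup (1 + η + 2 * Complex.I * t) (by rw [hre]; linarith) (by rw [hre]; linarith)
        (by rw [him, abs_mul]; norm_num; linarith)
      rw [him, abs_mul, abs_two] at this
      refine this.trans ?_
      rw [mul_assoc]
      gcongr
      exact two_mul_rpow_le (abs_nonneg _) (by norm_num)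
    have h4 : 1 ≤ (A₂ / η) ^ 3 * ‖riemannZeta (1 + η + Complex.I * t)‖ ^ 4 *
        (A * 2 * |t| ^ (1 / 50 : ℝ)) := h1.trans (by gcongr)
    calc η ^ 3 = η ^ 3 * 1 := by ring
      _ ≤ η ^ 3 * ((A₂ / η) ^ 3 * ‖riemannZeta (1 + η + Complex.I * t)‖ ^ 4 *
        (A * 2 * |t| ^ (1 / 50 : ℝ))) := by gcongr
      _ = _ := by rw [hA₃]; field_simp
  set c : ℝ := 1 / (256 * A₁ ^ 4 * A₃) with hc
  have hden : 256 ≤ 256 * A₁ ^ 4 * A₃ := by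
    rw [mul_assoc]
    exact le_mul_of_one_le_right (by norm_num)
      (one_le_mul_of_one_le_of_one_le (one_le_pow₀ hA₁) hA₃1)
  have hc0 : 0 < c := by positivity
  have hc1 : c ≤ 1 / 200 := one_div_le_one_div_of_le (by norm_num) (by linarith)
  refine ⟨c, hc0, hc1, fun s hs hs2 ht => ?_⟩
  set T : ℝ := |s.im| with hT
  have hT0 : 0 < T := by linarith
  set u : ℝ := T ^ (1 / 50 : ℝ) with hu
  have hu0 : 0 < u := by positivity
  set η : ℝ := c * T ^ (-(1 / 10) : ℝ) with hη
  have hη0 : 0 < η := by positivity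
  have hu5 : T ^ (-(1 / 10) : ℝ) * u ^ 5 = 1 := by
    rw [hu, ← Real.rpow_natCast, ← Real.rpow_mul hT0.le, ← Real.rpow_add hT0]
    norm_num
  have hη1 : η ≤ 1 / 200 := by
    refine (mul_le_of_le_one_right hc0.le ?_).trans hc1
    exact Real.rpow_le_one_of_one_le_of_nonpos (by linarith) (by norm_num)
  have hηu : 256 * A₁ ^ 4 * A₃ * u ^ 5 * η = 1 := by
    calc _ = 256 * A₁ ^ 4 * A₃ * c * (T ^ (-(1 / 10) : ℝ) * u ^ 5) := by rw [hη]; ring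
      _ = 1 := by rw [hu5, hc]; field_simp
  -- the bound at `σ ≥ 1 + η`
  have hright : ∀ σ : ℝ, 1 + η ≤ σ → σ ≤ 2 →
      4 * η * A₁ * u ≤ ‖riemannZeta (σ + s.im * Complex.I)‖ := by
    intro σ hσ hσ2
    have h1 := hlow (σ - 1) (by linarith) (by linarith) s.im ht
    rw [show (1 + ((σ - 1 : ℝ) : ℂ) + Complex.I * s.im : ℂ) = σ + s.im * Complex.I by
      push_cast; ring] at h1
    have h2 : η ^ 3 ≤ (σ - 1) ^ 3 := by gcongr; linarith
    refine le_of_pow_le_pow_left₀ (n := 4) (by norm_num) (norm_nonneg _) ?_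
    have h3 : 0 < A₃ * u := by positivity
    rw [← mul_le_mul_iff_right₀ h3]
    refine le_trans (le_of_eq ?_) (h2.trans h1)
    calc A₃ * u * (4 * η * A₁ * u) ^ 4 = (256 * A₁ ^ 4 * A₃ * u ^ 5 * η) * η ^ 3 := by ring
      _ = η ^ 3 := by rw [hηu, one_mul]
  have hlower : 2 * η * A₁ * u ≤ ‖riemannZeta s‖ := by
    have hsd : (s.re + s.im * Complex.I : ℂ) = s := Complex.re_add_im s
    have hpos : 0 < η * A₁ * u := by positivity
    rcases le_total (1 + η) s.re with h | h
    · have := hright s.re h hs2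
      rw [hsd] at this
      linarith
    · have h1 := hright (1 + η) le_rfl (by linarith)
      have h2 := norm_image_sub_le_of_norm_deriv_le_segment'
        (f := fun y : ℝ => riemannZeta (y + s.im * Complex.I))
        (f' := fun y : ℝ => deriv riemannZeta (y + s.im * Complex.I)) (a := s.re) (b := 1 + η)
        (C := A₁ * u) ?_ ?_ (1 + η) ⟨h, le_rfl⟩
      · rw [hsd] at h2
        have h3 : A₁ * u * (1 + η - s.re) ≤ A₁ * u * (2 * η) := by gcongr; linarith
        have h4 := norm_sub_norm_le (riemannZeta ((1 + η : ℝ) + s.im * Complex.I)) (riemannZeta s)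
        linarith
      · intro y hy
        have hd : DifferentiableAt ℂ riemannZeta (y + s.im * Complex.I) := by
          refine differentiableAt_riemannZeta fun h0 => ?_
          have := congrArg Complex.im h0
          simp only [Complex.add_im, Complex.ofReal_im, Complex.mul_im, Complex.ofReal_re,
            Complex.I_im, Complex.I_re, Complex.one_im, mul_one, mul_zero, zero_add,
            add_zero] at this
          rw [hT, this] at ht
          norm_num at ht
        have := (hd.hasDerivAt.comp_add_const (y : ℂ) (s.im * Complex.I)).comp_ofReal
        exact this.hasDerivWithinAt
      · intro y hy
        have him : (y + s.im * Complex.I : ℂ).im = s.im := by simp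
        have hre : (y + s.im * Complex.I : ℂ).re = y := by simp
        have := hder (y + s.im * Complex.I) (by rw [hre]; linarith [hy.1])
          (by rw [hre]; linarith [hy.2]) (by rw [him]; exact ht)
        rwa [him] at this
  have hpos : 0 < 2 * η * A₁ * u := by positivity
  have hne : riemannZeta s ≠ 0 := by
    rw [← norm_pos_iff]; linarith
  refine ⟨hne, ?_⟩
  rw [norm_div, div_le_div_iff₀ (norm_pos_iff.mpr hne) (by positivity), one_mul]
  have := hder s (by linarith) hs2 ht
  calc ‖deriv riemannZeta s‖ * (2 * η) ≤ A₁ * u * (2 * η) := by gcongr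
    _ = 2 * η * A₁ * u := by ring
    _ ≤ _ := hlower

/-- `-ζ'/ζ - ζ`, the Dirichlet series of `Λ - 1`. -/
noncomputable def zetaDiff (s : ℂ) : ℂ := -deriv riemannZeta s / riemannZeta s - riemannZeta s

theorem differentiableAt_zetaDiff {s : ℂ} (hs : s ≠ 1) (hz : riemannZeta s ≠ 0) :
    DifferentiableAt ℂ zetaDiff s := by
  have h1 : DifferentiableAt ℂ riemannZeta s := differentiableAt_riemannZeta hs
  have h2 : DifferentiableAt ℂ (deriv riemannZeta) s :=
    (analyticOn_riemannZeta.deriv s hs).differentiableAt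
  exact (h2.neg.div h1 hz).sub h1

theorem exists_norm_iteratedDeriv_zetaDiff_le_of_three_le :
    ∃ C : ℝ, 0 < C ∧ ∀ s : ℂ, 1 < s.re → s.re ≤ 3 / 2 → 3 ≤ |s.im| →
      ‖iteratedDeriv 4 zetaDiff s‖ ≤ C * |s.im| ^ (1 / 2 : ℝ) := by
  obtain ⟨A, hA, hup⟩ := exists_norm_riemannZeta_le_abs_im
  obtain ⟨c, hc, hc1, hzf⟩ := exists_zeroFree
  refine ⟨24 * (1 / c + 2 * A) / (c / 2) ^ 4, by positivity, fun s hs hs2 ht => ?_⟩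
  set T : ℝ := |s.im| with hT
  have hT0 : 0 < T := by linarith
  set v : ℝ := T ^ (1 / 10 : ℝ) with hv
  have hv0 : 0 < v := by positivity
  have hvn : T ^ (-(1 / 10) : ℝ) = v⁻¹ := Real.rpow_neg hT0.le _
  set ρ : ℝ := c / 2 * v⁻¹ with hρ
  have hρ0 : 0 < ρ := by positivity
  have hv1 : 1 ≤ v := Real.one_le_rpow (by linarith) (by norm_num)
  have hρ1 : ρ ≤ 1 / 400 := by
    calc ρ ≤ c / 2 * 1 := by
          rw [hρ]; gcongr; exact inv_le_one_of_one_le₀ hv1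
      _ ≤ 1 / 400 := by linarith
  have key : ∀ z : ℂ, ‖z - s‖ ≤ ρ → z ≠ 1 ∧ riemannZeta z ≠ 0 ∧
      ‖zetaDiff z‖ ≤ (1 / c + 2 * A) * v := by
    intro z hz
    obtain ⟨h1, h2, h3⟩ := abs_im_le_of_mem_closedBall hz
    rw [abs_le] at h1
    have hz2 : 2 ≤ |z.im| := by linarith
    have hz0 : 0 < |z.im| := by linarith
    have hw : |z.im| ^ (1 / 10 : ℝ) ≤ 2 * v := by
      refine le_trans ?_ (two_mul_rpow_le hT0.le (by norm_num))
      gcongr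
      linarith
    have hw' : (2 * v)⁻¹ ≤ |z.im| ^ (-(1 / 10) : ℝ) := by
      rw [Real.rpow_neg hz0.le]
      gcongr
    have hw0 : 0 < |z.im| ^ (-(1 / 10) : ℝ) := by positivity
    have hcρ : ρ ≤ c * |z.im| ^ (-(1 / 10) : ℝ) := by
      calc ρ = c * (2 * v)⁻¹ := by rw [hρ, mul_inv]; ring
        _ ≤ _ := by gcongr
    obtain ⟨h4, h5⟩ := hzf z (by linarith) (by linarith) hz2
    refine ⟨?_, h4, ?_⟩
    · rintro rfl
      norm_num at hz2
    · have h6 := hup z (by linarith) (by linarith) (by linarith)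
      have h7 : |z.im| ^ (1 / 50 : ℝ) ≤ 2 * v :=
        (Real.rpow_le_rpow_of_exponent_le (by linarith) (by norm_num)).trans hw
      have h8 : 1 / (2 * (c * |z.im| ^ (-(1 / 10) : ℝ))) ≤ 1 / c * v := by
        calc 1 / (2 * (c * |z.im| ^ (-(1 / 10) : ℝ))) ≤ 1 / (2 * ρ) := by gcongr
          _ = 1 / c * v := by rw [hρ]; field_simp
      calc ‖zetaDiff z‖ ≤ ‖deriv riemannZeta z / riemannZeta z‖ + ‖riemannZeta z‖ := by
            refine (norm_sub_le _ _).trans ?_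
            rw [neg_div, norm_neg]
        _ ≤ 1 / c * v + A * (2 * v) := by
            refine add_le_add (h5.trans h8) (h6.trans ?_)
            gcongr
        _ = _ := by ring
  have hd : DiffContOnCl ℂ zetaDiff (Metric.ball s ρ) := by
    refine DifferentiableOn.diffContOnCl ?_
    rw [closure_ball _ hρ0.ne']
    intro z hz
    obtain ⟨h1, h2, -⟩ := key z (by simpa [dist_eq_norm] using Metric.mem_closedBall.mp hz)
    exact (differentiableAt_zetaDiff h1 h2).differentiableWithinAt
  refine (Complex.norm_iteratedDeriv_le_of_forall_mem_sphere_norm_le 4 hρ0 hd fun z hz =>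
    (key z (by simpa [dist_eq_norm] using (Metric.mem_sphere.mp hz).le)).2.2).trans (le_of_eq ?_)
  have hv5 : T ^ (1 / 2 : ℝ) = v ^ 5 := by
    rw [hv, ← Real.rpow_natCast, ← Real.rpow_mul hT0.le]
    norm_num
  rw [hv5, hρ]
  simp only [Nat.factorial]
  push_cast
  field_simp

/-- An analytic function on a neighbourhood of `1 ≤ re s` that agrees with `zetaDiff`
away from `s = 1`. -/
noncomputable def zetaDiffReg (s : ℂ) : ℂ :=
  -deriv zetaReg s / zetaReg s - dslope zetaReg 1 s

theorem zetaDiff_eq_zetaDiffReg {s : ℂ} (hs : s ≠ 1) (hz : riemannZeta s ≠ 0) :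
    zetaDiff s = zetaDiffReg s := by
  have h1 : s - 1 ≠ 0 := sub_ne_zero.mpr hs
  have hd : deriv zetaReg s = riemannZeta s + (s - 1) * deriv riemannZeta s := by
    have e : zetaReg =ᶠ[nhds s] fun z => (z - 1) * riemannZeta z := by
      filter_upwards [eventually_ne_nhds hs] with z hz using zetaReg_of_ne_one hz
    rw [e.deriv_eq]
    have := (((hasDerivAt_id s).sub_const 1).mul (differentiableAt_riemannZeta hs).hasDerivAt).deriv
    simpa [Pi.mul_def] using this
  rw [zetaDiffReg, zetaDiff, dslope_of_ne _ hs, slope_def_field, hd, zetaReg_of_ne_one hs,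
    zetaReg_one]
  field_simp
  ring

theorem exists_norm_iteratedDeriv_zetaDiff_le_of_le_three :
    ∃ C : ℝ, 0 < C ∧ ∀ s : ℂ, 1 < s.re → s.re ≤ 3 / 2 → |s.im| ≤ 3 →
      ‖iteratedDeriv 4 zetaDiff s‖ ≤ C := by
  have hopen : IsOpen {z : ℂ | zetaReg z ≠ 0} :=
    isOpen_ne_fun differentiable_zetaReg.continuous continuous_const
  have han : AnalyticOnNhd ℂ zetaDiffReg {z : ℂ | zetaReg z ≠ 0} := by
    refine DifferentiableOn.analyticOnNhd (fun z hz => ?_) hopen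
    have h1 : DifferentiableAt ℂ (deriv zetaReg) z :=
      (differentiable_zetaReg.analyticAt z).deriv.differentiableAt
    have h2 : DifferentiableAt ℂ (dslope zetaReg 1) z :=
      ((Complex.differentiableOn_dslope (s := Set.univ) univ_mem).mpr
        differentiable_zetaReg.differentiableOn).differentiableAt univ_mem
    exact ((h1.neg.div (differentiable_zetaReg z) hz).sub h2).differentiableWithinAt
  have hcont : ContinuousOn (iteratedDeriv 4 zetaDiffReg)
      (Set.Icc 1 (3 / 2) ×ℂ Set.Icc (-3) 3) := by
    intro z hz
    have hz1 : 1 ≤ z.re := hz.1.1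
    have := (han.iterated_deriv 4 z (zetaReg_ne_zero hz1)).continuousAt
    rw [← iteratedDeriv_eq_iterate] at this
    exact this.continuousWithinAt
  obtain ⟨C, hC⟩ := (isCompact_Icc.reProdIm isCompact_Icc).exists_bound_of_continuousOn hcont
  refine ⟨max C 1, by positivity, fun s hs hs2 ht => ?_⟩
  have e : zetaDiff =ᶠ[nhds s] zetaDiffReg := by
    filter_upwards [(isOpen_lt continuous_const Complex.continuous_re).mem_nhds hs] with z hz
    have hz : 1 < z.re := hz
    refine zetaDiff_eq_zetaDiffReg ?_ (riemannZeta_ne_zero_of_one_le_re hz.le)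
    rintro rfl
    norm_num at hz
  rw [e.iteratedDeriv_eq]
  exact (hC s ⟨⟨hs.le, hs2⟩, abs_le.mp ht⟩).trans (le_max_left _ _)

theorem exists_norm_iteratedDeriv_zetaDiff_le :
    ∃ C : ℝ, 0 < C ∧ ∀ s : ℂ, 1 < s.re → s.re ≤ 3 / 2 →
      ‖iteratedDeriv 4 zetaDiff s‖ ≤ C * (1 + |s.im|) ^ (1 / 2 : ℝ) := by
  obtain ⟨C₁, h1, H1⟩ := exists_norm_iteratedDeriv_zetaDiff_le_of_three_le
  obtain ⟨C₂, h2, H2⟩ := exists_norm_iteratedDeriv_zetaDiff_le_of_le_three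
  refine ⟨C₁ + C₂, by positivity, fun s hs hs2 => ?_⟩
  have hT := abs_nonneg s.im
  rcases le_total |s.im| 3 with h | h
  · have h3 : 1 ≤ (1 + |s.im|) ^ (1 / 2 : ℝ) := Real.one_le_rpow (by linarith) (by norm_num)
    nlinarith [H2 s hs hs2 h]
  · have h3 : |s.im| ^ (1 / 2 : ℝ) ≤ (1 + |s.im|) ^ (1 / 2 : ℝ) := by gcongr; linarith
    calc _ ≤ C₁ * |s.im| ^ (1 / 2 : ℝ) := H1 s hs hs2 h
      _ ≤ _ := by gcongr; linarith

theorem hasMellin_max_one_sub_zero {s : ℂ} (hs : 0 < s.re) :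
    HasMellin (fun u : ℝ => ((max (1 - u) 0 : ℝ) : ℂ)) s (1 / (s * (s + 1))) := by
  have h1 := hasMellin_one_Ioc hs
  have h2 := hasMellin_cpow_Ioc 1 (s := s) (by simp only [Complex.one_re]; linarith)
  have h3 := hasMellin_sub h1.1 h2.1
  rw [h1.2, h2.2] at h3
  have hs0 : s ≠ 0 := fun h => by simp [h] at hs
  have hs1 : s + 1 ≠ 0 := fun h => by
    have := congrArg Complex.re h
    simp only [Complex.add_re, Complex.one_re, Complex.zero_re] at this
    linarith
  have heq : Set.EqOn (fun u : ℝ => ((max (1 - u) 0 : ℝ) : ℂ))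
      (fun t => (Set.Ioc (0 : ℝ) 1).indicator (fun _ => (1 : ℂ)) t -
        (Set.Ioc (0 : ℝ) 1).indicator (fun t : ℝ => (t : ℂ) ^ (1 : ℂ)) t) (Set.Ioi 0) := by
    intro u hu
    have hu : 0 < u := hu
    by_cases h : u ≤ 1
    · simp [Set.indicator_of_mem (show u ∈ Set.Ioc (0 : ℝ) 1 from ⟨hu, h⟩), h]
    · have hn : u ∉ Set.Ioc (0 : ℝ) 1 := fun h' => h h'.2
      simp [Set.indicator_of_notMem hn, (not_le.mp h).le]
  refine ⟨?_, ?_⟩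
  · refine (h3.1 : MeasureTheory.IntegrableOn _ _ _).congr_fun (fun u hu => ?_) measurableSet_Ioi
    simp only [heq hu]
  · have h4 := h3.2
    rw [mellin] at h4 ⊢
    rw [MeasureTheory.setIntegral_congr_fun measurableSet_Ioi
      (fun u hu => by simp only [heq hu] : Set.EqOn _ (fun t : ℝ => (t : ℂ) ^ (s - 1) •
        ((Set.Ioc (0 : ℝ) 1).indicator (fun _ => (1 : ℂ)) t -
        (Set.Ioc (0 : ℝ) 1).indicator (fun t : ℝ => (t : ℂ) ^ (1 : ℂ)) t)) (Set.Ioi 0)), h4]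
    field_simp
    ring

theorem norm_one_div_mul_add_one_le {s : ℂ} (hs : 1 ≤ s.re) :
    ‖1 / (s * (s + 1))‖ ≤ 2 * (1 + |s.im|) ^ (-2 : ℝ) := by
  have h1 : (1 + |s.im|) ^ 2 ≤ 2 * ‖s‖ ^ 2 := by
    rw [← Complex.normSq_eq_norm_sq, Complex.normSq_apply]
    nlinarith [abs_mul_abs_self s.im, sq_nonneg (|s.im| - 1)]
  have h2 : ‖s‖ ≤ ‖s + 1‖ := by
    rw [← sq_le_sq₀ (norm_nonneg _) (norm_nonneg _), ← Complex.normSq_eq_norm_sq,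
      ← Complex.normSq_eq_norm_sq, Complex.normSq_apply, Complex.normSq_apply]
    simp only [Complex.add_re, Complex.one_re, Complex.add_im, Complex.one_im]
    nlinarith
  have hpos : 0 < 1 + |s.im| := by positivity
  have hs0 : 0 < ‖s‖ := norm_pos_iff.mpr fun h => by norm_num [h] at hs
  have hs1 : 0 < ‖s + 1‖ := hs0.trans_le h2
  rw [Real.rpow_neg hpos.le, norm_div, norm_mul, norm_one, ← div_eq_mul_inv,
    div_le_div_iff₀ (by positivity) (by positivity)]
  norm_num
  nlinarith

theorem continuous_one_div_mul_add_one {σ : ℝ} (hσ : 0 < σ) :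
    Continuous fun y : ℝ => 1 / ((σ + y * Complex.I) * (σ + y * Complex.I + 1) : ℂ) := by
  refine continuous_const.div (by fun_prop) fun y => mul_ne_zero (fun h => ?_) fun h => ?_
  · have := congrArg Complex.re h
    simp at this
    linarith
  · have := congrArg Complex.re h
    simp at this
    linarith

theorem integrable_one_div_mul_add_one {σ : ℝ} (hσ : 1 ≤ σ) :
    MeasureTheory.Integrable
      fun y : ℝ => 1 / ((σ + y * Complex.I) * (σ + y * Complex.I + 1) : ℂ) := by
  refine MeasureTheory.Integrable.mono'
    ((integrable_one_add_norm (E := ℝ) (r := 2) (by norm_num)).const_mul 2)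
    (continuous_one_div_mul_add_one (by linarith)).aestronglyMeasurable
    (Eventually.of_forall fun y => ?_)
  simpa using norm_one_div_mul_add_one_le (s := σ + y * Complex.I) (by simpa using hσ)

theorem max_one_sub_zero_eq_integral {σ u : ℝ} (hσ : 1 ≤ σ) (hu : 0 < u) :
    ((max (1 - u) 0 : ℝ) : ℂ) = (1 / (2 * Real.pi)) • ∫ y : ℝ, (u : ℂ) ^ (-(σ + y * Complex.I)) *
      (1 / ((σ + y * Complex.I) * (σ + y * Complex.I + 1))) := by
  have hm : ∀ y : ℝ, mellin (fun u : ℝ => ((max (1 - u) 0 : ℝ) : ℂ)) (σ + y * Complex.I) =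
      1 / ((σ + y * Complex.I) * (σ + y * Complex.I + 1)) := fun y =>
    (hasMellin_max_one_sub_zero (by simp; linarith)).2
  have h := mellinInv_mellin_eq σ (fun u : ℝ => ((max (1 - u) 0 : ℝ) : ℂ)) hu
    (hasMellin_max_one_sub_zero (by simp; linarith)).1
    ((integrable_one_div_mul_add_one hσ).congr (Eventually.of_forall fun y => (hm y).symm))
    (by fun_prop)
  rw [← h, mellinInv]
  simp only [hm, smul_eq_mul]

/-- Perron's formula with a Cesàro weight. -/
theorem tsum_mul_max_eq_integral {f : ℕ → ℂ} {σ x : ℝ} (hσ : 1 ≤ σ) (hx : 0 < x) (hf0 : f 0 = 0)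
    (hf : LSeriesSummable f σ) :
    ∑' n : ℕ, f n * ((max (1 - n / x) 0 : ℝ) : ℂ) =
      (1 / (2 * Real.pi)) • ∫ y : ℝ, LSeries f (σ + y * Complex.I) *
        ((x : ℂ) ^ (σ + y * Complex.I : ℂ) *
          (1 / ((σ + y * Complex.I) * (σ + y * Complex.I + 1)))) := by
  set k : ℝ → ℂ := fun y => (x : ℂ) ^ (σ + y * Complex.I : ℂ) *
          (1 / ((σ + y * Complex.I) * (σ + y * Complex.I + 1))) with hk
  have hxs : ∀ y : ℝ, ‖(x : ℂ) ^ (σ + y * Complex.I : ℂ)‖ = x ^ σ := fun y => by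
    rw [Complex.norm_cpow_eq_rpow_re_of_pos hx]; simp
  have hki : MeasureTheory.Integrable k := by
    refine (integrable_one_div_mul_add_one hσ).bdd_mul (c := x ^ σ)
      (Continuous.aestronglyMeasurable ?_) (Eventually.of_forall fun y => (hxs y).le)
    exact Continuous.const_cpow (by fun_prop) (Or.inl (by exact_mod_cast hx.ne'))
  have hterm : ∀ n : ℕ, ∀ y : ℝ, ‖LSeries.term f (σ + y * Complex.I) n‖ =
      ‖LSeries.term f σ n‖ := fun n y => by
    rw [LSeries.norm_term_eq, LSeries.norm_term_eq]; simp
  have hint : ∀ n, MeasureTheory.Integrable fun y : ℝ =>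
      LSeries.term f (σ + y * Complex.I) n * k y := fun n => by
    refine hki.bdd_mul (c := ‖LSeries.term f σ n‖)
      (Continuous.aestronglyMeasurable ?_) (Eventually.of_forall fun y => (hterm n y).le)
    rcases eq_or_ne n 0 with rfl | hn
    · simpa using continuous_const
    · simp only [LSeries.term_of_ne_zero hn]
      refine continuous_const.div (Continuous.const_cpow (by fun_prop)
        (Or.inl (by exact_mod_cast hn))) fun y => ?_
      simp [Complex.cpow_eq_zero_iff, hn]
  have hsum := MeasureTheory.hasSum_integral_of_summable_integral_norm hint (by
    simp only [norm_mul, hterm, MeasureTheory.integral_const_mul]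
    exact hf.norm.mul_right _)
  have hR : ∀ y : ℝ, ∑' n, LSeries.term f (σ + y * Complex.I) n * k y =
      LSeries f (σ + y * Complex.I) * k y := fun y => by rw [tsum_mul_right, LSeries]
  simp only [hR] at hsum
  rw [← hsum.tsum_eq, ← tsum_const_smul'']
  refine tsum_congr fun n => ?_
  rcases eq_or_ne n 0 with rfl | hn
  · simp [hf0]
  have hn0 : (0 : ℝ) < n := by exact_mod_cast Nat.pos_of_ne_zero hn
  rw [max_one_sub_zero_eq_integral hσ (div_pos hn0 hx), mul_smul_comm,
    ← MeasureTheory.integral_const_mul]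
  congr 2
  funext y
  rw [LSeries.term_of_ne_zero hn, hk]
  have e : ((n / x : ℝ) : ℂ) ^ (-(σ + y * Complex.I : ℂ)) =
      (x : ℂ) ^ (σ + y * Complex.I : ℂ) / (n : ℂ) ^ (σ + y * Complex.I : ℂ) := by
    rw [Complex.cpow_neg, div_eq_mul_inv, Complex.ofReal_mul, Complex.mul_cpow_ofReal_nonneg hn0.le
      (by positivity), mul_inv, Complex.ofReal_inv, Complex.inv_cpow, inv_inv,
      Complex.ofReal_natCast]
    · field_simp
    · rw [Complex.arg_ofReal_of_nonneg hx.le]; exact Real.pi_pos.ne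
  rw [e]
  ring

/-- The coefficients of the fourth derivative of `-ζ'/ζ - ζ`. -/
noncomputable def logPowMulVonMangoldtSubOne (n : ℕ) : ℝ :=
  Real.log n ^ 4 * (ArithmeticFunction.vonMangoldt n - 1)

theorem logMul_iterate_apply (f : ℕ → ℂ) (m n : ℕ) :
    (LSeries.logMul^[m] f) n = Complex.log n ^ m * f n := by
  induction m generalizing f with
  | zero => simp
  | succ m ih => rw [Function.iterate_succ_apply, ih, LSeries.logMul, pow_succ, mul_assoc]

theorem LSeries_logPowMulVonMangoldtSubOne {s : ℂ} (hs : 1 < s.re) :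
    LSeriesSummable (fun n => (logPowMulVonMangoldtSubOne n : ℂ)) s ∧
    LSeries (fun n => (logPowMulVonMangoldtSubOne n : ℂ)) s = iteratedDeriv 4 zetaDiff s := by
  set g : ℕ → ℂ := (fun n => ((ArithmeticFunction.vonMangoldt n : ℝ) : ℂ)) - 1 with hg
  have hf : (fun n => (logPowMulVonMangoldtSubOne n : ℂ)) = LSeries.logMul^[4] g := by
    funext n
    rw [logMul_iterate_apply, hg, logPowMulVonMangoldtSubOne]
    push_cast [Complex.natCast_log]
    simp
  have hsum : ∀ z : ℂ, 1 < z.re → LSeriesSummable g z := fun z hz =>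
    (ArithmeticFunction.LSeriesSummable_vonMangoldt hz).sub (LSeriesSummable_one_iff.mpr hz)
  have habs : LSeries.abscissaOfAbsConv g < s.re :=
    (LSeries.abscissaOfAbsConv_le_of_forall_lt_LSeriesSummable (x := 1)
      fun y hy => hsum y (by simpa using hy)).trans_lt (by exact_mod_cast hs)
  have heq : LSeries g =ᶠ[nhds s] zetaDiff := by
    filter_upwards [(isOpen_lt continuous_const Complex.continuous_re).mem_nhds hs] with z hz
    rw [hg, LSeries_sub (ArithmeticFunction.LSeriesSummable_vonMangoldt hz)
      (LSeriesSummable_one_iff.mpr hz), LSeries_one_eq_riemannZeta hz,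
      ArithmeticFunction.LSeries_vonMangoldt_eq_deriv_riemannZeta_div hz, zetaDiff]
  rw [hf]
  refine ⟨LSeriesSummable_of_abscissaOfAbsConv_lt_re
    (LSeries.absicssaOfAbsConv_logPowMul.trans_lt habs), ?_⟩
  rw [← heq.iteratedDeriv_eq 4, LSeries_iteratedDeriv 4 habs]
  norm_num

theorem exists_abs_sum_mul_max_le :
    ∃ C, 0 < C ∧ ∀ x : ℝ, 0 < x →
      |∑ n ∈ Ioc 0 ⌊x⌋₊, logPowMulVonMangoldtSubOne n * (1 - n / x)| ≤ C * x := by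
  obtain ⟨C, hC, hb⟩ := exists_norm_iteratedDeriv_zetaDiff_le
  set J : ℝ := ∫ y : ℝ, (1 + ‖y‖) ^ (-(3 / 2 : ℝ)) with hJ
  have hJi := integrable_one_add_norm (E := ℝ) (μ := MeasureTheory.volume) (r := 3 / 2)
    (by norm_num)
  have hJ0 : 0 ≤ J := MeasureTheory.integral_nonneg fun y => by positivity
  refine ⟨2 * C * J + 1, by positivity, fun x hx => ?_⟩
  have hfin : ((∑ n ∈ Ioc 0 ⌊x⌋₊, logPowMulVonMangoldtSubOne n * (1 - n / x) : ℝ) : ℂ) =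
      ∑' n : ℕ, (logPowMulVonMangoldtSubOne n : ℂ) * ((max (1 - n / x) 0 : ℝ) : ℂ) := by
    rw [tsum_eq_sum (s := Ioc 0 ⌊x⌋₊)]
    · push_cast
      refine Finset.sum_congr rfl fun n hn => ?_
      have : (n : ℝ) ≤ x := (Nat.le_floor_iff hx.le).mp (Finset.mem_Ioc.mp hn).2
      have h1 : (n : ℝ) / x ≤ 1 := (div_le_one hx).mpr this
      rw [← Complex.ofReal_natCast, ← Complex.ofReal_div, ← Complex.ofReal_one,
        ← Complex.ofReal_sub, max_eq_left (by linarith)]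
    · intro n hn
      rcases Nat.eq_zero_or_pos n with rfl | hn0
      · simp [logPowMulVonMangoldtSubOne]
      · have : x < n := by
          rw [Finset.mem_Ioc, not_and, not_le] at hn
          exact (Nat.floor_lt hx.le).mp (hn hn0)
        have h1 : 1 ≤ (n : ℝ) / x := (one_le_div hx).mpr this.le
        rw [max_eq_right (by linarith)]
        simp
  have key : ∀ σ : ℝ, 1 < σ → σ ≤ 3 / 2 →
      |∑ n ∈ Ioc 0 ⌊x⌋₊, logPowMulVonMangoldtSubOne n * (1 - n / x)| ≤
        (2 * C * J) * x ^ σ := by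
    intro σ h1 h2
    have hs : 1 < (σ : ℂ).re := by simpa using h1
    obtain ⟨hsum, -⟩ := LSeries_logPowMulVonMangoldtSubOne hs
    rw [← Real.norm_eq_abs, ← Complex.norm_real, hfin,
      tsum_mul_max_eq_integral h1.le hx (by simp [logPowMulVonMangoldtSubOne]) hsum, norm_smul]
    have hpi : ‖1 / (2 * Real.pi)‖ ≤ 1 := by
      rw [Real.norm_of_nonneg (by positivity), div_le_one (by positivity)]
      linarith [Real.pi_gt_three]
    refine (mul_le_of_le_one_left (norm_nonneg _) hpi).trans ?_
    have hI := MeasureTheory.norm_integral_le_of_norm_le (hJi.const_mul (2 * C * x ^ σ))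
      (f := fun y : ℝ => LSeries (fun n => (logPowMulVonMangoldtSubOne n : ℂ))
        (σ + y * Complex.I) * ((x : ℂ) ^ (σ + y * Complex.I : ℂ) *
          (1 / ((σ + y * Complex.I) * (σ + y * Complex.I + 1)))))
      (Eventually.of_forall fun y => ?_)
    · rw [MeasureTheory.integral_const_mul, ← hJ] at hI
      exact hI.trans (by linarith)
    · have hre : (σ + y * Complex.I : ℂ).re = σ := by simp
      have him : (σ + y * Complex.I : ℂ).im = y := by simp
      have b1 := hb (σ + y * Complex.I) (by rwa [hre]) (by rwa [hre])
      have b2 := norm_one_div_mul_add_one_le (s := σ + y * Complex.I) (by rw [hre]; exact h1.le)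
      rw [(LSeries_logPowMulVonMangoldtSubOne (by rwa [hre])).2, norm_mul, norm_mul,
        Complex.norm_cpow_eq_rpow_re_of_pos hx, hre, Real.norm_eq_abs]
      rw [him] at b1 b2
      have hy : 0 < 1 + |y| := by positivity
      calc _ ≤ (C * (1 + |y|) ^ (1 / 2 : ℝ)) * (x ^ σ * (2 * (1 + |y|) ^ (-2 : ℝ))) := by
            gcongr
        _ = 2 * C * x ^ σ * ((1 + |y|) ^ (1 / 2 : ℝ) * (1 + |y|) ^ (-2 : ℝ)) := by ring
        _ = _ := by rw [← Real.rpow_add hy]; norm_num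
  have hlim : Tendsto (fun σ : ℝ => (2 * C * J) * x ^ σ) (nhdsWithin 1 (Set.Ioi 1))
      (nhds ((2 * C * J) * x ^ (1 : ℝ))) :=
    (((Real.continuous_const_rpow hx.ne').const_mul _).tendsto 1).mono_left nhdsWithin_le_nhds
  have hle := ge_of_tendsto hlim (by
    filter_upwards [Ioc_mem_nhdsGT (show (1 : ℝ) < 3 / 2 by norm_num)] with σ hσ
    exact key σ hσ.1 hσ.2)
  rw [Real.rpow_one] at hle
  nlinarith

theorem neg_le_sum_Ioc_mul {b w : ℕ → ℝ} {x h M : ℝ} (hx : 0 ≤ x) (hh : 0 ≤ h) (hM : 0 ≤ M)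
    (hb : ∀ n : ℕ, (n : ℝ) ≤ x + h → -M ≤ b n)
    (hw : ∀ n : ℕ, x < n → (n : ℝ) ≤ x + h → 0 ≤ w n ∧ w n ≤ h) :
    -((h + 1) * (h * M)) ≤ ∑ n ∈ Ioc ⌊x⌋₊ ⌊x + h⌋₊, b n * w n := by
  have hterm : ∀ n ∈ Ioc ⌊x⌋₊ ⌊x + h⌋₊, -(h * M) ≤ b n * w n := fun n hn => by
    have h1 : x < n := (Nat.floor_lt hx).mp (Finset.mem_Ioc.mp hn).1
    have h2 : (n : ℝ) ≤ x + h := (Nat.le_floor_iff (by positivity)).mp (Finset.mem_Ioc.mp hn).2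
    obtain ⟨h3, h4⟩ := hw n h1 h2
    nlinarith [mul_le_mul_of_nonneg_right (hb n h2) h3]
  have hcard : ((Ioc ⌊x⌋₊ ⌊x + h⌋₊).card : ℝ) ≤ h + 1 := by
    rw [Nat.card_Ioc, Nat.cast_sub (Nat.floor_mono (by linarith))]
    linarith [Nat.lt_floor_add_one x, Nat.floor_le (show 0 ≤ x + h by positivity)]
  have h5 := Finset.card_nsmul_le_sum _ _ _ hterm
  rw [nsmul_eq_mul] at h5
  nlinarith [mul_nonneg hh hM]

/-- Bounds for a partial sum in terms of its first iterated integral. -/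
theorem mul_sum_Ioc_le_and_le {b : ℕ → ℝ} {x h M : ℝ} (hh : 0 ≤ h) (hhx : h ≤ x)
    (hM : 0 ≤ M) (hb : ∀ n : ℕ, (n : ℝ) ≤ x + h → -M ≤ b n) :
    h * ∑ n ∈ Ioc 0 ⌊x⌋₊, b n ≤ ∑ n ∈ Ioc 0 ⌊x + h⌋₊, b n * (x + h - n) -
        ∑ n ∈ Ioc 0 ⌊x⌋₊, b n * (x - n) + (h + 1) * (h * M) ∧
      ∑ n ∈ Ioc 0 ⌊x⌋₊, b n * (x - n) - ∑ n ∈ Ioc 0 ⌊x - h⌋₊, b n * (x - h - n) -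
        (h + 1) * (h * M) ≤ h * ∑ n ∈ Ioc 0 ⌊x⌋₊, b n := by
  have hx : 0 ≤ x := hh.trans hhx
  constructor
  · have h1 := neg_le_sum_Ioc_mul hx hh hM hb (w := fun n => x + h - n)
      (fun n h1 h2 => ⟨by linarith, by linarith⟩)
    rw [← Finset.sum_Ioc_consecutive _ (Nat.zero_le _)
      (Nat.floor_mono (show x ≤ x + h by linarith))]
    have h2 : ∑ n ∈ Ioc 0 ⌊x⌋₊, b n * (x + h - n) =
        ∑ n ∈ Ioc 0 ⌊x⌋₊, b n * (x - n) + h * ∑ n ∈ Ioc 0 ⌊x⌋₊, b n := by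
      rw [Finset.mul_sum, ← Finset.sum_add_distrib]
      exact Finset.sum_congr rfl fun n _ => by ring
    linarith
  · have h1 := neg_le_sum_Ioc_mul (x := x - h) (b := b) (sub_nonneg.mpr hhx) hh hM
      (fun n hn => hb n (by linarith)) (w := fun n => n - (x - h))
      (fun n h1 h2 => ⟨by linarith, by linarith⟩)
    rw [sub_add_cancel] at h1
    have h2 : ∑ n ∈ Ioc 0 ⌊x⌋₊, b n * (x - h - n) =
        ∑ n ∈ Ioc 0 ⌊x⌋₊, b n * (x - n) - h * ∑ n ∈ Ioc 0 ⌊x⌋₊, b n := by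
      rw [Finset.mul_sum, ← Finset.sum_sub_distrib]
      exact Finset.sum_congr rfl fun n _ => by ring
    have h3 := Finset.sum_Ioc_consecutive (fun n : ℕ => b n * (x - h - n)) (Nat.zero_le _)
      (Nat.floor_mono (show x - h ≤ x by linarith))
    have h4 : ∑ n ∈ Ioc ⌊x - h⌋₊ ⌊x⌋₊, b n * (x - h - n) =
        -∑ n ∈ Ioc ⌊x - h⌋₊ ⌊x⌋₊, b n * (n - (x - h)) := by
      rw [← Finset.sum_neg_distrib]
      exact Finset.sum_congr rfl fun n _ => by ring
    linarith

theorem log_sq_le {x : ℝ} (hx : 0 ≤ x) (h1 : 1 ≤ x) : Real.log x ^ 2 ≤ 4 * x := by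
  have h := Real.log_le_rpow_div hx (show (0 : ℝ) < 1 / 2 by norm_num)
  have h0 := Real.log_nonneg h1
  have h2 : (x ^ (1 / 2 : ℝ)) ^ 2 = x := by
    rw [← Real.rpow_natCast, ← Real.rpow_mul hx]; norm_num
  have h3 : Real.log x ≤ 2 * x ^ (1 / 2 : ℝ) := by linarith
  nlinarith

theorem exists_abs_sum_logPowMul_le :
    ∃ C, 0 < C ∧ ∀ x : ℝ, 3 ≤ x →
      |∑ n ∈ Ioc 0 ⌊x⌋₊, logPowMulVonMangoldtSubOne n| ≤ C * (x * Real.log x ^ 2) := by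
  obtain ⟨C, hC, hb⟩ := exists_abs_sum_mul_max_le
  have hD : ∀ x : ℝ, 0 ≤ x →
      |∑ n ∈ Ioc 0 ⌊x⌋₊, logPowMulVonMangoldtSubOne n * (x - n)| ≤ C * x ^ 2 := by
    intro x hx
    rcases hx.eq_or_lt with rfl | hx
    · simp
    have h1 : ∑ n ∈ Ioc 0 ⌊x⌋₊, logPowMulVonMangoldtSubOne n * (x - n) =
        x * ∑ n ∈ Ioc 0 ⌊x⌋₊, logPowMulVonMangoldtSubOne n * (1 - n / x) := by
      rw [Finset.mul_sum]
      exact Finset.sum_congr rfl fun n _ => by field_simp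
    rw [h1, abs_mul, abs_of_pos hx]
    nlinarith [hb x hx]
  refine ⟨5 * C + 80, by positivity, fun x hx => ?_⟩
  have hx0 : 0 < x := by linarith
  set L := Real.log x with hL
  have hL1 : 1 ≤ L := by
    rw [hL, Real.le_log_iff_exp_le hx0]
    linarith [Real.exp_one_lt_d9]
  set h := x / L ^ 2 with hh
  have hh0 : 0 < h := by positivity
  have hhL : h * L ^ 2 = x := by rw [hh]; field_simp
  have hhx : h ≤ x := div_le_self hx0.le (one_le_pow₀ hL1)
  have hh4 : 1 ≤ 4 * h := by
    have := log_sq_le hx0.le (by linarith : 1 ≤ x)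
    rw [← hL] at this
    have : 1 ≤ 4 * x / L ^ 2 := (one_le_div (by positivity)).mpr this
    rw [hh]; linarith [mul_div_assoc 4 x (L ^ 2)]
  have hM : ∀ n : ℕ, (n : ℝ) ≤ x + h → -(16 * L ^ 4) ≤ logPowMulVonMangoldtSubOne n := by
    intro n hn
    have h1 : Real.log n ≤ 2 * L := by
      rcases Nat.eq_zero_or_pos n with rfl | hn0
      · simp; linarith
      · have : (n : ℝ) ≤ x ^ 2 := by nlinarith
        have h2 := Real.log_le_log (by exact_mod_cast hn0) this
        rw [Real.log_pow] at h2
        simpa using h2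
    have h2 : Real.log n ^ 4 ≤ (2 * L) ^ 4 := pow_le_pow_left₀ (Real.log_natCast_nonneg n) h1 4
    have h3 : 0 ≤ ArithmeticFunction.vonMangoldt n := ArithmeticFunction.vonMangoldt_nonneg
    rw [logPowMulVonMangoldtSubOne]
    nlinarith [pow_nonneg (Real.log_natCast_nonneg n) 4]
  obtain ⟨hu, hl⟩ := mul_sum_Ioc_le_and_le hh0.le hhx (by positivity) hM
  have d1 := abs_le.mp (hD (x + h) (by linarith))
  have d2 := abs_le.mp (hD x hx0.le)
  have d3 := abs_le.mp (hD (x - h) (by linarith))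
  have e1 : (x + h) ^ 2 ≤ 4 * x ^ 2 := by nlinarith
  have e2 : (x - h) ^ 2 ≤ x ^ 2 := by nlinarith
  have e3 : (h + 1) * (h * (16 * L ^ 4)) ≤ 80 * x ^ 2 := by
    calc (h + 1) * (h * (16 * L ^ 4)) ≤ (5 * h) * (h * (16 * L ^ 4)) := by gcongr; linarith
      _ = 80 * (h * L ^ 2) ^ 2 := by ring
      _ = 80 * x ^ 2 := by rw [hhL]
  have e4 : h * ((5 * C + 80) * (x * L ^ 2)) = (5 * C + 80) * x ^ 2 := by
    calc _ = (5 * C + 80) * x * (h * L ^ 2) := by ring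
      _ = _ := by rw [hhL]; ring
  rw [abs_le]
  constructor
  · refine le_of_mul_le_mul_left ?_ hh0
    rw [mul_neg, e4]
    nlinarith
  · refine le_of_mul_le_mul_left ?_ hh0
    rw [e4]
    nlinarith

/-- `t ^ (1 / 2) / log t ^ k` is increasing up to a constant. -/
theorem sqrt_div_log_pow_le (k : ℕ) {t y : ℝ} (ht : 2 ≤ t) (hty : t ≤ y) :
    t ^ (1 / 2 : ℝ) / Real.log t ^ k ≤
      (1 + 2 * (k + 1) / Real.log 2) ^ k * (y ^ (1 / 2 : ℝ) / Real.log y ^ k) := by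
  have hl2 : 0 < Real.log 2 := Real.log_pos (by norm_num)
  have ht0 : 0 < t := by linarith
  have hy0 : 0 < y := by linarith
  have hlt : Real.log 2 ≤ Real.log t := Real.log_le_log (by norm_num) ht
  have hlt0 : 0 < Real.log t := hl2.trans_le hlt
  have hly0 : 0 < Real.log y := hlt0.trans_le (Real.log_le_log ht0 hty)
  set c := 1 + 2 * (k + 1) / Real.log 2 with hc
  set u := y / t with hu
  have hu1 : 1 ≤ u := (one_le_div ht0).mpr hty
  set ε : ℝ := 1 / (2 * (k + 1)) with hε
  have hε0 : 0 < ε := by positivity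
  have huε : 1 ≤ u ^ ε := Real.one_le_rpow hu1 hε0.le
  have hlu := Real.log_le_rpow_div (by linarith : 0 ≤ u) hε0
  have hyt : y = u * t := by rw [hu]; field_simp
  have h1 : Real.log y ≤ c * u ^ ε * Real.log t := by
    have e : Real.log y = Real.log u + Real.log t := by
      rw [hyt, Real.log_mul (by positivity) ht0.ne']
    have h2 : u ^ ε / ε ≤ (2 * (k + 1) / Real.log 2) * u ^ ε * Real.log t := by
      rw [hε]
      calc u ^ ε / (1 / (2 * (k + 1))) = (2 * (k + 1) / Real.log 2) * u ^ ε * Real.log 2 := by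
            field_simp
        _ ≤ _ := by gcongr
    rw [e, hc]
    nlinarith
  have h2 : Real.log y ^ k ≤ c ^ k * (u ^ ε) ^ k * Real.log t ^ k := by
    rw [← mul_pow, ← mul_pow]; exact pow_le_pow_left₀ hly0.le h1 k
  have h3 : (u ^ ε) ^ k ≤ u ^ (1 / 2 : ℝ) := by
    rw [← Real.rpow_natCast, ← Real.rpow_mul (by linarith)]
    refine Real.rpow_le_rpow_of_exponent_le hu1 ?_
    rw [hε, div_mul_eq_mul_div, one_mul, div_le_div_iff₀ (by positivity) (by norm_num)]
    linarith
  rw [← mul_div_assoc, div_le_div_iff₀ (by positivity) (by positivity), hyt,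
    Real.mul_rpow (by linarith) ht0.le, ← hyt]
  calc t ^ (1 / 2 : ℝ) * Real.log y ^ k
      ≤ t ^ (1 / 2 : ℝ) * (c ^ k * u ^ (1 / 2 : ℝ) * Real.log t ^ k) := by
        have hc0 : 0 < c := by positivity
        gcongr
        exact h2.trans (by gcongr)
    _ = _ := by ring

theorem continuousOn_rpow_div_log_pow (α : ℝ) (k : ℕ) {a b : ℝ} (ha : 1 < a) :
    ContinuousOn (fun t : ℝ => t ^ α / Real.log t ^ k) (Set.Icc a b) := by
  intro t ht
  have ht1 : 1 < t := ha.trans_le ht.1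
  have := Real.log_pos ht1
  refine ContinuousAt.continuousWithinAt ?_
  exact (Real.continuousAt_rpow_const _ _ (Or.inl (by linarith))).div
    ((Real.continuousAt_log (by linarith)).pow k) (by positivity)

theorem exists_integral_rpow_div_log_pow_le {α : ℝ} (hα : 0 ≤ α) (k : ℕ) :
    ∃ C, 0 < C ∧ ∀ y : ℝ, 2 ≤ y →
      ∫ t in (2 : ℝ)..y, t ^ α / Real.log t ^ k ≤ C * (y ^ (α + 1) / Real.log y ^ k) := by
  have hl2 : 0 < Real.log 2 := Real.log_pos (by norm_num)
  refine ⟨(1 + 2 * (k + 1) / Real.log 2) ^ k / (α + 1 / 2), by positivity, fun y hy => ?_⟩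
  set c := (1 + 2 * (k + 1) / Real.log 2) ^ k with hc
  have hc0 : 0 < c := by positivity
  have hly : 0 < Real.log y := Real.log_pos (by linarith)
  have hy0 : 0 < y := by linarith
  have h1 : ∫ t in (2 : ℝ)..y, t ^ α / Real.log t ^ k ≤
      ∫ t in (2 : ℝ)..y, (c * (y ^ (1 / 2 : ℝ) / Real.log y ^ k)) * t ^ (α - 1 / 2) := by
    refine intervalIntegral.integral_mono_on hy
      ((continuousOn_rpow_div_log_pow α k (by norm_num)).intervalIntegrable_of_Icc hy)
      ((intervalIntegral.intervalIntegrable_rpow' (by linarith)).const_mul _) fun t ht => ?_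
    have ht0 : 0 < t := by linarith [ht.1]
    have e : t ^ α = t ^ (1 / 2 : ℝ) * t ^ (α - 1 / 2) := by
      rw [← Real.rpow_add ht0]; congr 1; ring
    rw [e, mul_div_right_comm]
    exact mul_le_mul_of_nonneg_right (sqrt_div_log_pow_le k ht.1 ht.2) (by positivity)
  rw [intervalIntegral.integral_const_mul, integral_rpow (Or.inl (by linarith))] at h1
  have e1 : α - 1 / 2 + 1 = α + 1 / 2 := by ring
  have e2 : y ^ (α + 1) = y ^ (1 / 2 : ℝ) * y ^ (α + 1 / 2) := by
    rw [← Real.rpow_add hy0]; congr 1; ring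
  rw [e1] at h1
  refine h1.trans ?_
  rw [e2]
  calc _ ≤ c * (y ^ (1 / 2 : ℝ) / Real.log y ^ k) * (y ^ (α + 1 / 2) / (α + 1 / 2)) := by
        gcongr
        linarith [Real.rpow_nonneg (show (0 : ℝ) ≤ 2 by norm_num) (α + 1 / 2)]
    _ = _ := by field_simp

/-- Partial summation against a summatory function close to `κ t`. -/
theorem abs_sum_mul_sub_integral_le {c : ℕ → ℝ} {f f' e g : ℝ → ℝ} {a b : ℝ} (κ : ℝ) (ha : 0 ≤ a)
    (hab : a ≤ b) (hf : ∀ t ∈ Set.Icc a b, HasDerivAt f (f' t) t)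
    (hf' : ContinuousOn f' (Set.Icc a b)) (hg : ContinuousOn g (Set.Icc a b))
    (he : ∀ t ∈ Set.Icc a b, |∑ k ∈ Icc 0 ⌊t⌋₊, c k - κ * t| ≤ e t)
    (hfg : ∀ t ∈ Set.Icc a b, |f' t| * e t ≤ g t) :
    |∑ k ∈ Ioc ⌊a⌋₊ ⌊b⌋₊, f k * c k - κ * ∫ t in a..b, f t| ≤
      |f b| * e b + |f a| * e a + ∫ t in a..b, g t := by
  set S : ℝ → ℝ := fun t => ∑ k ∈ Icc 0 ⌊t⌋₊, c k with hS
  have hderiv : Set.EqOn (deriv f) f' (Set.Icc a b) := fun t ht => (hf t ht).deriv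
  have hint' : MeasureTheory.IntegrableOn f' (Set.Icc a b) := hf'.integrableOn_Icc
  have hcf : ContinuousOn f (Set.Icc a b) := fun t ht =>
    (hf t ht).continuousAt.continuousWithinAt
  have habel := sum_mul_eq_sub_sub_integral_mul c ha hab
    (fun t ht => (hf t ht).differentiableAt) (hint'.congr_fun hderiv.symm measurableSet_Icc)
  rw [MeasureTheory.setIntegral_congr_fun measurableSet_Ioc
    (fun t ht => by simp only [hderiv (Set.Ioc_subset_Icc_self ht), hS] :
      Set.EqOn _ (fun t => f' t * S t) (Set.Ioc a b)),
    ← intervalIntegral.integral_of_le hab] at habel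
  have hI1 : IntervalIntegrable (fun t => f' t * S t) MeasureTheory.volume a b :=
    (intervalIntegrable_iff_integrableOn_Icc_of_le hab).mpr (integrableOn_mul_sum_Icc c ha hint')
  have hI2 : IntervalIntegrable (fun t => f' t * (κ * t)) MeasureTheory.volume a b :=
    (hf'.mul (by fun_prop)).intervalIntegrable_of_Icc hab
  have hparts := intervalIntegral.integral_mul_deriv_eq_deriv_mul (a := a) (b := b)
    (u := f) (v := fun t => κ * t) (u' := f') (v' := fun _ => κ)
    (fun t ht => hf t (by rwa [Set.uIcc_of_le hab] at ht))
    (fun t _ => by simpa using (hasDerivAt_id t).const_mul κ)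
    (hf'.intervalIntegrable_of_Icc hab) intervalIntegrable_const
  rw [intervalIntegral.integral_mul_const] at hparts
  have hsub : ∫ t in a..b, f' t * (S t - κ * t) =
      (∫ t in a..b, f' t * S t) - ∫ t in a..b, f' t * (κ * t) := by
    rw [← intervalIntegral.integral_sub hI1 hI2]
    exact intervalIntegral.integral_congr fun t _ => by ring
  have hbd : |∫ t in a..b, f' t * (S t - κ * t)| ≤ ∫ t in a..b, g t := by
    rw [← Real.norm_eq_abs]
    refine intervalIntegral.norm_integral_le_of_norm_le hab
      (Eventually.of_forall fun t ht => ?_) (hg.intervalIntegrable_of_Icc hab)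
    have ht' := Set.Ioc_subset_Icc_self ht
    rw [Real.norm_eq_abs, abs_mul]
    exact (mul_le_mul_of_nonneg_left (he t ht') (abs_nonneg _)).trans (hfg t ht')
  have heq : ∑ k ∈ Ioc ⌊a⌋₊ ⌊b⌋₊, f k * c k - κ * ∫ t in a..b, f t =
      f b * (S b - κ * b) - f a * (S a - κ * a) - ∫ t in a..b, f' t * (S t - κ * t) := by
    rw [habel, hsub]
    linarith
  rw [heq]
  have h1 : |f b * (S b - κ * b)| ≤ |f b| * e b := by
    rw [abs_mul]; exact mul_le_mul_of_nonneg_left (he b ⟨hab, le_rfl⟩) (abs_nonneg _)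
  have h2 : |f a * (S a - κ * a)| ≤ |f a| * e a := by
    rw [abs_mul]; exact mul_le_mul_of_nonneg_left (he a ⟨le_rfl, hab⟩) (abs_nonneg _)
  rw [abs_le] at *
  constructor <;> linarith

theorem hasDerivAt_rpow_div_log_pow (α : ℝ) (k : ℕ) {t : ℝ} (ht : 1 < t) :
    HasDerivAt (fun t : ℝ => t ^ α / Real.log t ^ k)
      (α * (t ^ (α - 1) / Real.log t ^ k) - k * (t ^ (α - 1) / Real.log t ^ (k + 1))) t := by
  have hl := Real.log_pos ht
  have ht0 : 0 < t := by linarith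
  have h := (Real.hasDerivAt_rpow_const (x := t) (p := α) (Or.inl ht0.ne')).div
    ((Real.hasDerivAt_log ht0.ne').pow k) (pow_pos hl k).ne'
  refine h.congr_deriv ?_
  have e : t ^ α = t ^ (α - 1) * t := by
    rw [← Real.rpow_add_one ht0.ne']; congr 1; ring
  simp only [Pi.pow_apply]
  rw [e]
  rcases k with _ | k
  · simp
  · rw [Nat.add_sub_cancel]
    push_cast
    field_simp
    ring

theorem exists_abs_sum_vonMangoldt_sub_one_le :
    ∃ C, 0 < C ∧ ∀ x : ℝ, 3 ≤ x →
      |∑ n ∈ Ioc 3 ⌊x⌋₊, (ArithmeticFunction.vonMangoldt n - 1)| ≤ C * (x / Real.log x ^ 2) := by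
  obtain ⟨C, hC, hb⟩ := exists_abs_sum_logPowMul_le
  obtain ⟨A, hA, hint⟩ := exists_integral_rpow_div_log_pow_le le_rfl 3
  have hl3 : 1 ≤ Real.log 3 := by
    rw [Real.le_log_iff_exp_le (by norm_num)]
    linarith [Real.exp_one_lt_d9]
  refine ⟨C + 12 * C + 4 * C * A, by positivity, fun x hx => ?_⟩
  have hx0 : 0 < x := by linarith
  have hlx : 1 ≤ Real.log x := hl3.trans (Real.log_le_log (by norm_num) hx)
  have hcont : ∀ (β : ℝ) (k : ℕ),
      ContinuousOn (fun t : ℝ => t ^ β / Real.log t ^ k) (Set.Icc 3 x) :=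
    fun β k => continuousOn_rpow_div_log_pow β k (by norm_num)
  have hmain := abs_sum_mul_sub_integral_le (c := logPowMulVonMangoldtSubOne)
    (f := fun t => t ^ (0 : ℝ) / Real.log t ^ 4) (e := fun t => C * (t * Real.log t ^ 2))
    (g := fun t => 4 * C * (t ^ (0 : ℝ) / Real.log t ^ 3)) 0 (by norm_num) hx
    (fun t ht => hasDerivAt_rpow_div_log_pow 0 4 (by linarith [ht.1]))
    ((continuousOn_const.mul (hcont _ _)).sub (continuousOn_const.mul (hcont _ _)))
    (continuousOn_const.mul (hcont _ _))
    (fun t ht => by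
      rw [zero_mul, sub_zero, Finset.Icc_eq_cons_Ioc (Nat.zero_le _), Finset.sum_cons]
      simpa [logPowMulVonMangoldtSubOne] using hb t ht.1)
    (fun t ht => by
      have ht0 : 0 < t := by linarith [ht.1]
      have hlt : 0 < Real.log t := Real.log_pos (by linarith [ht.1])
      rw [zero_mul, zero_sub, abs_neg, zero_sub, Real.rpow_neg_one, Real.rpow_zero,
        abs_of_nonneg (by positivity)]
      refine le_of_eq ?_
      push_cast
      field_simp)
  simp only [zero_mul, sub_zero, Nat.floor_ofNat, Real.rpow_zero] at hmain
  rw [intervalIntegral.integral_const_mul] at hmain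
  have hsum : ∑ n ∈ Ioc 3 ⌊x⌋₊, (ArithmeticFunction.vonMangoldt n - 1) =
      ∑ n ∈ Ioc 3 ⌊x⌋₊, 1 / Real.log n ^ 4 * logPowMulVonMangoldtSubOne n := by
    refine Finset.sum_congr rfl fun n hn => ?_
    have hn1 : (1 : ℝ) < n := by
      exact_mod_cast (by norm_num : 1 < 3).trans (Finset.mem_Ioc.mp hn).1
    have := Real.log_pos hn1
    rw [logPowMulVonMangoldtSubOne]
    field_simp
  have hI : ∫ t in (3 : ℝ)..x, 1 / Real.log t ^ 3 ≤ A * (x / Real.log x ^ 2) := by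
    have hle : ∫ t in (3 : ℝ)..x, 1 / Real.log t ^ 3 ≤ ∫ t in (2 : ℝ)..x, 1 / Real.log t ^ 3 := by
      refine intervalIntegral.integral_mono_interval (by norm_num) hx le_rfl ?_ ?_
      · filter_upwards [MeasureTheory.ae_restrict_mem measurableSet_Ioc] with t ht
        have : 0 ≤ Real.log t := Real.log_nonneg (by linarith [ht.1])
        positivity
      · have := (continuousOn_rpow_div_log_pow 0 3 (a := 2) (b := x)
          (by norm_num)).intervalIntegrable_of_Icc (μ := MeasureTheory.volume) (by linarith)
        simpa only [Real.rpow_zero] using this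
    have h2 := hint x (by linarith)
    simp only [Real.rpow_zero, zero_add, Real.rpow_one] at h2
    refine hle.trans (h2.trans ?_)
    have h3 : Real.log x ^ 2 ≤ Real.log x ^ 3 := pow_le_pow_right₀ hlx (by norm_num)
    gcongr
  have hq : 1 ≤ 4 * (x / Real.log x ^ 2) := by
    rw [← mul_div_assoc, le_div_iff₀ (by positivity), one_mul]
    exact log_sq_le hx0.le (by linarith)
  have e1 : |1 / Real.log x ^ 4| * (C * (x * Real.log x ^ 2)) = C * (x / Real.log x ^ 2) := by
    rw [abs_of_nonneg (by positivity)]; field_simp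
  have e2 : |1 / Real.log 3 ^ 4| * (C * (3 * Real.log 3 ^ 2)) ≤ 3 * C := by
    rw [abs_of_nonneg (by positivity)]
    calc _ = 3 * C * (1 / Real.log 3 ^ 2) := by field_simp
      _ ≤ 3 * C * 1 := by
        gcongr
        exact (div_le_one (by positivity)).mpr (one_le_pow₀ hl3)
      _ = _ := by ring
  rw [hsum]
  nlinarith [mul_le_mul_of_nonneg_left hI (by positivity : 0 ≤ 4 * C)]

theorem log_pow_three_le {x : ℝ} (h1 : 1 ≤ x) : Real.log x ^ 3 ≤ 216 * √x := by
  have hx : 0 ≤ x := by linarith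
  have h := Real.log_le_rpow_div hx (show (0 : ℝ) < 1 / 6 by norm_num)
  have h0 := Real.log_nonneg h1
  have h2 : (x ^ (1 / 6 : ℝ)) ^ 3 = √x := by
    rw [← Real.rpow_natCast, ← Real.rpow_mul hx, Real.sqrt_eq_rpow]; norm_num
  calc Real.log x ^ 3 ≤ (6 * x ^ (1 / 6 : ℝ)) ^ 3 := pow_le_pow_left₀ h0 (by linarith) 3
    _ = 216 * √x := by rw [mul_pow, h2]; norm_num

/-- The prime number theorem with error term `O(x / log² x)`. -/
theorem exists_abs_theta_sub_le :
    ∃ K, 0 < K ∧ ∀ x : ℝ, 2 ≤ x → |Chebyshev.theta x - x| ≤ K * (x / Real.log x ^ 2) := by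
  obtain ⟨C, hC, hb⟩ := exists_abs_sum_vonMangoldt_sub_one_le
  set K₀ := |∑ n ∈ Ioc 0 3, (ArithmeticFunction.vonMangoldt n - 1)| with hK₀
  have hK0 : 0 ≤ K₀ := abs_nonneg _
  refine ⟨C + 4 * K₀ + 4 + 432 + 12, by positivity, fun x hx => ?_⟩
  have hx0 : 0 < x := by linarith
  have hlx : 0 < Real.log x := Real.log_pos (by linarith)
  have hq : 0 < x / Real.log x ^ 2 := by positivity
  rcases lt_or_ge x 3 with h3 | h3
  · have h4 : Real.log 4 ≤ 2 := by
      rw [show (4 : ℝ) = 2 ^ 2 by norm_num, Real.log_pow]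
      push_cast
      linarith [Real.log_two_lt_d9]
    have h5 := Chebyshev.theta_le_log4_mul_x hx0.le
    have h6 : 0 ≤ Chebyshev.theta x := Chebyshev.theta_nonneg x
    have h7 : Real.log x ≤ 2 := by linarith [Real.log_le_sub_one_of_pos hx0]
    have h8 : x ≤ 4 * (x / Real.log x ^ 2) := by
      rw [← mul_div_assoc, le_div_iff₀ (by positivity)]
      nlinarith [mul_nonneg hx0.le (show 0 ≤ 4 - Real.log x ^ 2 by nlinarith)]
    have h9 : |Chebyshev.theta x - x| ≤ 3 * x := by
      rw [abs_le]; constructor <;> nlinarith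
    nlinarith
  · have h1 : 1 ≤ 4 * (x / Real.log x ^ 2) := by
      rw [← mul_div_assoc, le_div_iff₀ (by positivity), one_mul]
      exact log_sq_le hx0.le (by linarith)
    have h2 : 2 * √x * Real.log x ≤ 432 * (x / Real.log x ^ 2) := by
      rw [← mul_div_assoc, le_div_iff₀ (by positivity)]
      nlinarith [log_pow_three_le (show 1 ≤ x by linarith), Real.mul_self_sqrt hx0.le,
        Real.sqrt_nonneg x]
    have h4 := Chebyshev.abs_psi_sub_theta_le_sqrt_mul_log (x := x) (by linarith)
    have h5 : Chebyshev.psi x - ⌊x⌋₊ = ∑ n ∈ Ioc 0 3, (ArithmeticFunction.vonMangoldt n - 1) +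
        ∑ n ∈ Ioc 3 ⌊x⌋₊, (ArithmeticFunction.vonMangoldt n - 1) := by
      rw [Finset.sum_Ioc_consecutive _ (Nat.zero_le _) (Nat.le_floor (by exact_mod_cast h3)),
        Finset.sum_sub_distrib, Chebyshev.psi]
      simp
    have h6 := hb x h3
    have h7 := Nat.floor_le hx0.le
    have h8 := Nat.lt_floor_add_one x
    have h9 := le_abs_self (∑ n ∈ Ioc 0 3, (ArithmeticFunction.vonMangoldt n - 1))
    have h10 := neg_abs_le (∑ n ∈ Ioc 0 3, (ArithmeticFunction.vonMangoldt n - 1))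
    rw [← hK₀] at h9 h10
    have h11 : K₀ ≤ 4 * K₀ * (x / Real.log x ^ 2) := by nlinarith
    rw [abs_le] at *
    constructor <;> nlinarith

theorem exists_abs_sum_log_mul_sub_integral_le :
    ∃ K, 0 < K ∧ ∀ (f f' g : ℝ → ℝ) (a b : ℝ), 2 ≤ a → a ≤ b →
      (∀ t ∈ Set.Icc a b, HasDerivAt f (f' t) t) → ContinuousOn f' (Set.Icc a b) →
      ContinuousOn g (Set.Icc a b) → (∀ t ∈ Set.Icc a b, |f' t| * (t / Real.log t ^ 2) ≤ g t) →
      |∑ p ∈ (Ioc ⌊a⌋₊ ⌊b⌋₊).filter Nat.Prime, f p * Real.log p - ∫ t in a..b, f t| ≤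
        K * (|f b| * (b / Real.log b ^ 2) + |f a| * (a / Real.log a ^ 2) + ∫ t in a..b, g t) := by
  obtain ⟨K, hK, hθ⟩ := exists_abs_theta_sub_le
  refine ⟨K, hK, fun f f' g a b ha hab hf hf' hg hfg => ?_⟩
  have h := abs_sum_mul_sub_integral_le (c := fun n => if n.Prime then Real.log n else 0)
    (f := f) (f' := f') (e := fun t => K * (t / Real.log t ^ 2)) (g := fun t => K * g t) 1
    (by linarith) hab hf hf' (continuousOn_const.mul hg)
    (fun t ht => by
      simpa only [Chebyshev.theta_eq_sum_Icc, Finset.sum_filter, one_mul] using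
        hθ t (ha.trans ht.1))
    (fun t ht => by nlinarith [hfg t ht])
  rw [one_mul, intervalIntegral.integral_const_mul] at h
  rw [Finset.sum_filter]
  simp only [mul_ite, mul_zero] at h
  exact h.trans (le_of_eq (by ring))

theorem exists_abs_sum_prime_rpow_sub_le {α : ℝ} (hα : 0 < α) :
    ∃ C, 0 < C ∧ ∀ y : ℝ, 2 ≤ y →
      |∑ q ∈ (Icc 2 ⌊y⌋₊).filter Nat.Prime, (q : ℝ) ^ α -
        (y ^ (α + 1) / ((α + 1) * Real.log y) + y ^ (α + 1) / ((α + 1) ^ 2 * Real.log y ^ 2))| ≤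
        C * (y ^ (α + 1) / Real.log y ^ 3) := by
  obtain ⟨K, hK, hsum⟩ := exists_abs_sum_log_mul_sub_integral_le
  obtain ⟨A, hA, hint⟩ := exists_integral_rpow_div_log_pow_le hα.le 3
  have hl2 : 1 / 2 < Real.log 2 := by linarith [Real.log_two_gt_d9]
  set M : ℝ → ℝ := fun y => 1 / (α + 1) * (y ^ (α + 1) / Real.log y ^ 1) +
    1 / (α + 1) ^ 2 * (y ^ (α + 1) / Real.log y ^ 2) with hM
  have hMd : ∀ t : ℝ, 1 < t → HasDerivAt M (t ^ α / Real.log t ^ 1 -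
      2 / (α + 1) ^ 2 * (t ^ α / Real.log t ^ 3)) t := fun t ht => by
    refine (((hasDerivAt_rpow_div_log_pow (α + 1) 1 ht).const_mul _).add
      ((hasDerivAt_rpow_div_log_pow (α + 1) 2 ht).const_mul _)).congr_deriv ?_
    have := Real.log_pos ht
    rw [add_sub_cancel_right]
    push_cast
    field_simp
    ring
  refine ⟨216 * (2 ^ α + |M 2| + K * (|2 ^ α / Real.log 2 ^ 1| * (2 / Real.log 2 ^ 2))) +
    2 / (α + 1) ^ 2 * A + K * (1 + (α + 2) * A), by positivity, fun y hy => ?_⟩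
  have hy0 : 0 < y := by linarith
  have hly : 0 < Real.log y := Real.log_pos (by linarith)
  set Q := y ^ (α + 1) / Real.log y ^ 3 with hQ
  have hQ1 : 1 ≤ 216 * Q := by
    rw [hQ, ← mul_div_assoc, le_div_iff₀ (by positivity), one_mul]
    refine (log_pow_three_le (by linarith)).trans ?_
    rw [Real.sqrt_eq_rpow]
    gcongr <;> linarith
  have hcont : ∀ k : ℕ, ContinuousOn (fun t : ℝ => t ^ α / Real.log t ^ k) (Set.Icc 2 y) :=
    fun k => continuousOn_rpow_div_log_pow α k (by norm_num)
  have hcont' : ∀ k : ℕ, ContinuousOn (fun t : ℝ => t ^ (α - 1) / Real.log t ^ k) (Set.Icc 2 y) :=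
    fun k => continuousOn_rpow_div_log_pow _ k (by norm_num)
  have h1 := hsum (fun t => t ^ α / Real.log t ^ 1) _
    (fun t => (α + 2) * (t ^ α / Real.log t ^ 3)) 2 y le_rfl hy
    (fun t ht => hasDerivAt_rpow_div_log_pow α 1 (by linarith [ht.1]))
    ((continuousOn_const.mul (hcont' _)).sub (continuousOn_const.mul (hcont' _)))
    (continuousOn_const.mul (hcont _)) (fun t ht => by
      have ht0 : 0 < t := by linarith [ht.1]
      have hlt : 1 / 2 < Real.log t := hl2.trans_le (Real.log_le_log (by norm_num) ht.1)
      have hlt0 : 0 < Real.log t := by linarith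
      have e : t ^ α = t ^ (α - 1) * t := by
        rw [← Real.rpow_add_one ht0.ne']; congr 1; ring
      have h2 : 1 / Real.log t ≤ 2 := by
        rw [div_le_iff₀ hlt0]; linarith
      calc _ ≤ (α * (t ^ (α - 1) / Real.log t ^ 1) +
            ((1 : ℕ) : ℝ) * (t ^ (α - 1) / Real.log t ^ (1 + 1))) * (t / Real.log t ^ 2) := by
            refine mul_le_mul_of_nonneg_right ?_ (by positivity)
            refine (abs_sub _ _).trans (le_of_eq ?_)
            rw [abs_of_nonneg (by positivity), abs_of_nonneg (by positivity)]
        _ = (α + 1 / Real.log t) * (t ^ α / Real.log t ^ 3) := by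
            rw [e]; push_cast; field_simp
        _ ≤ _ := by gcongr)
  have h2 := hint y hy
  have h3 : ∫ t in (2 : ℝ)..y, t ^ α / Real.log t ^ 1 =
      M y - M 2 + 2 / (α + 1) ^ 2 * ∫ t in (2 : ℝ)..y, t ^ α / Real.log t ^ 3 := by
    have hi : ∀ k : ℕ, IntervalIntegrable (fun t : ℝ => t ^ α / Real.log t ^ k)
        MeasureTheory.volume 2 y := fun k => (hcont k).intervalIntegrable_of_Icc hy
    have := intervalIntegral.integral_eq_sub_of_hasDerivAt (a := 2) (b := y) (f := M)
      (fun t ht => hMd t (by rw [Set.uIcc_of_le hy] at ht; linarith [ht.1]))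
      ((hi 1).sub ((hi 3).const_mul _))
    rw [intervalIntegral.integral_sub (hi 1) ((hi 3).const_mul _),
      intervalIntegral.integral_const_mul] at this
    linarith
  have h0 : 0 ≤ ∫ t in (2 : ℝ)..y, t ^ α / Real.log t ^ 3 :=
    intervalIntegral.integral_nonneg hy fun t ht => by
      have : 0 < Real.log t := Real.log_pos (by linarith [ht.1])
      have : 0 < t := by linarith [ht.1]
      positivity
  have h4 : ∑ q ∈ (Icc 2 ⌊y⌋₊).filter Nat.Prime, (q : ℝ) ^ α = 2 ^ α +
      ∑ p ∈ (Ioc 2 ⌊y⌋₊).filter Nat.Prime, (p : ℝ) ^ α / Real.log p ^ 1 * Real.log p := by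
    rw [Finset.sum_filter, Finset.sum_filter,
      Finset.Icc_eq_cons_Ioc (Nat.le_floor (by exact_mod_cast hy)), Finset.sum_cons,
      if_pos Nat.prime_two]
    congr 1
    refine Finset.sum_congr rfl fun p hp => ?_
    have hp1 : (1 : ℝ) < p := by
      exact_mod_cast (by norm_num : 1 < 2).trans (Finset.mem_Ioc.mp hp).1
    have := Real.log_pos hp1
    congr 1
    field_simp
  have h5 : y ^ (α + 1) / ((α + 1) * Real.log y) +
      y ^ (α + 1) / ((α + 1) ^ 2 * Real.log y ^ 2) = M y := by
    rw [hM]; field_simp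
  have h6 : |y ^ α / Real.log y ^ 1| * (y / Real.log y ^ 2) = Q := by
    rw [abs_of_nonneg (by positivity), hQ, Real.rpow_add_one hy0.ne']; field_simp
  rw [Nat.floor_ofNat, h6, h3, intervalIntegral.integral_const_mul] at h1
  rw [h4, h5]
  have h7 : 0 ≤ (2 : ℝ) ^ α := by positivity
  set I := ∫ t in (2 : ℝ)..y, t ^ α / Real.log t ^ 3
  set B := |(2 : ℝ) ^ α / Real.log 2 ^ 1| * (2 / Real.log 2 ^ 2) with hB
  have hB0 : 0 ≤ B := by positivity
  have h8 : 2 / (α + 1) ^ 2 * I ≤ 2 / (α + 1) ^ 2 * (A * Q) := by gcongr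
  have h8' : 0 ≤ 2 / (α + 1) ^ 2 * I := by positivity
  have h9 : K * (Q + B + (α + 2) * I) ≤ K * (Q + B + (α + 2) * (A * Q)) := by gcongr
  have h10 : 2 ^ α + |M 2| + K * B ≤ (2 ^ α + |M 2| + K * B) * (216 * Q) :=
    le_mul_of_one_le_right (by positivity) hQ1
  have h11 := neg_abs_le (M 2)
  have h12 := le_abs_self (M 2)
  have h13 : 0 ≤ K * B := by positivity
  rw [abs_le] at h1 ⊢
  constructor <;> linarith [h1.1, h1.2]

theorem exists_abs_sum_log_mul_rpow_sub_le {β : ℝ} (hβ : 0 < β) :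
    ∃ C, 0 < C ∧ ∀ z P : ℝ, 2 ≤ z → z ≤ P →
      |∑ p ∈ (Ioc ⌊z⌋₊ ⌊P⌋₊).filter Nat.Prime, (p : ℝ) ^ (-β - 1) * Real.log p - z ^ (-β) / β| ≤
        P ^ (-β) / β + C * (z ^ (-β) / Real.log z ^ 2) := by
  obtain ⟨K, hK, hsum⟩ := exists_abs_sum_log_mul_sub_integral_le
  refine ⟨K * (2 + (β + 1) / β), by positivity, fun z P hz hzP => ?_⟩
  have hz0 : 0 < z := by linarith
  have hP0 : 0 < P := by linarith
  have hlz : 0 < Real.log z := Real.log_pos (by linarith)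
  have hlzP : Real.log z ≤ Real.log P := Real.log_le_log hz0 hzP
  have hcont : ∀ γ : ℝ, ContinuousOn (fun t : ℝ => t ^ γ) (Set.Icc z P) := fun γ t ht =>
    (Real.continuousAt_rpow_const _ _
      (Or.inl (by linarith [ht.1]))).continuousWithinAt
  have h1 := hsum (fun t => t ^ (-β - 1)) (fun t => (-β - 1) * t ^ (-β - 1 - 1))
    (fun t => (β + 1) / Real.log z ^ 2 * t ^ (-β - 1)) z P hz hzP
    (fun t ht => Real.hasDerivAt_rpow_const (Or.inl (by linarith [ht.1])))
    (continuousOn_const.mul (hcont _)) (continuousOn_const.mul (hcont _)) (fun t ht => by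
      have ht0 : 0 < t := by linarith [ht.1]
      have hlt : Real.log z ≤ Real.log t := Real.log_le_log hz0 ht.1
      have e : t ^ (-β - 1) = t ^ (-β - 1 - 1) * t := by
        rw [← Real.rpow_add_one ht0.ne']; congr 1; ring
      rw [abs_mul, abs_of_nonneg (by positivity : 0 ≤ t ^ (-β - 1 - 1)),
        abs_of_nonpos (by linarith : -β - 1 ≤ 0), e]
      calc _ = (β + 1) / Real.log t ^ 2 * (t ^ (-β - 1 - 1) * t) := by ring
        _ ≤ _ := by gcongr)
  have hI : ∫ t in z..P, t ^ (-β - 1) = (z ^ (-β) - P ^ (-β)) / β := by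
    rw [integral_rpow (Or.inr ⟨by linarith, fun h => by
      rw [Set.uIcc_of_le hzP] at h; linarith [h.1]⟩), sub_add_cancel]
    field_simp
    ring
  have e : ∀ t : ℝ, 0 < t → |t ^ (-β - 1)| * (t / Real.log t ^ 2) =
      t ^ (-β) / Real.log t ^ 2 := fun t ht => by
    rw [abs_of_nonneg (by positivity), Real.rpow_sub_one ht.ne']; field_simp
  have hPz : P ^ (-β) ≤ z ^ (-β) := Real.rpow_le_rpow_of_nonpos hz0 hzP (by linarith)
  have hbP : P ^ (-β) / Real.log P ^ 2 ≤ z ^ (-β) / Real.log z ^ 2 := by gcongr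
  rw [intervalIntegral.integral_const_mul, hI, e z hz0, e P hP0] at h1
  have hP' : 0 ≤ P ^ (-β) / β := by positivity
  have h2 : (β + 1) / Real.log z ^ 2 * ((z ^ (-β) - P ^ (-β)) / β) ≤
      (β + 1) / β * (z ^ (-β) / Real.log z ^ 2) := by
    calc _ ≤ (β + 1) / Real.log z ^ 2 * (z ^ (-β) / β) := by
          gcongr; linarith [Real.rpow_nonneg hP0.le (-β)]
      _ = _ := by field_simp
  have h3 : K * (P ^ (-β) / Real.log P ^ 2 + z ^ (-β) / Real.log z ^ 2 +
      (β + 1) / Real.log z ^ 2 * ((z ^ (-β) - P ^ (-β)) / β)) ≤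
      K * (2 + (β + 1) / β) * (z ^ (-β) / Real.log z ^ 2) := by
    rw [mul_assoc]
    gcongr
    linarith
  rw [sub_div] at h1 h3
  rw [abs_le] at h1 ⊢
  constructor <;> linarith [h1.1, h1.2]

theorem abs_one_div_mul_sub_le {L v : ℝ} (hL : 0 < L) (hv : 0 ≤ v) (hvL : v ≤ L / 4) :
    |1 / ((L / 2 - v) * (L / 2 + v)) - 4 / L ^ 2| ≤ 32 * v ^ 2 / L ^ 4 ∧
    |1 / ((L / 2 - v) ^ 2 * (L / 2 + v)) - 8 / L ^ 3| ≤ 64 * v / L ^ 4 ∧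
    1 / ((L / 2 - v) ^ 3 * (L / 2 + v)) ≤ 128 / L ^ 4 := by
  set l := L / 2 - v with hl
  set m := L / 2 + v with hm
  have hl4 : L / 4 ≤ l := by linarith
  have hm2 : L / 2 ≤ m := by linarith
  have hl0 : 0 < l := by linarith
  have hm0 : 0 < m := by linarith
  have hlm : L ^ 2 / 8 ≤ l * m := by nlinarith
  have h1 : |1 / (l * m) - 4 / L ^ 2| ≤ 32 * v ^ 2 / L ^ 4 := by
    have e : 1 / (l * m) - 4 / L ^ 2 = 4 * v ^ 2 / (L ^ 2 * (l * m)) := by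
      have : l * m = L ^ 2 / 4 - v ^ 2 := by rw [hl, hm]; ring
      field_simp
      rw [this]
      ring
    rw [e, abs_of_nonneg (by positivity)]
    calc 4 * v ^ 2 / (L ^ 2 * (l * m)) ≤ 4 * v ^ 2 / (L ^ 2 * (L ^ 2 / 8)) := by gcongr
      _ = _ := by field_simp; ring
  refine ⟨h1, ?_, ?_⟩
  · have e : 1 / (l ^ 2 * m) - 8 / L ^ 3 =
        1 / l * (1 / (l * m) - 4 / L ^ 2) + 8 * v / (L ^ 3 * l) := by
      have : L = 2 * (l + v) := by rw [hl]; ring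
      field_simp
      rw [this]
      ring
    have h2 : 1 / l ≤ 4 / L := by
      rw [div_le_div_iff₀ hl0 hL]; linarith
    rw [e]
    refine (abs_add_le _ _).trans ?_
    rw [abs_mul, abs_of_nonneg (by positivity : 0 ≤ 1 / l),
      abs_of_nonneg (by positivity : 0 ≤ 8 * v / (L ^ 3 * l))]
    calc _ ≤ 4 / L * (32 * v ^ 2 / L ^ 4) + 8 * v / (L ^ 3 * (L / 4)) := by gcongr
      _ = (32 * v / L ^ 4) * (v / (L / 4)) + 32 * v / L ^ 4 := by field_simp; ring
      _ ≤ (32 * v / L ^ 4) * 1 + 32 * v / L ^ 4 := by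
        gcongr
        exact (div_le_one (by positivity)).mpr hvL
      _ = _ := by ring
  · calc 1 / (l ^ 3 * m) ≤ 1 / ((L / 4) ^ 3 * (L / 2)) := by gcongr
      _ = _ := by field_simp; norm_num

theorem exists_abs_rpow_mul_sum_sub_le {α : ℝ} (hα : 0 < α) :
    ∃ D, 0 < D ∧ ∀ x p : ℝ, 1 < x → 1 < p → √x ≤ p → Real.log p ≤ 3 / 4 * Real.log x →
      2 ≤ x / p →
      |p ^ (-α) * ∑ q ∈ (Icc 2 ⌊x / p⌋₊).filter Nat.Prime, (q : ℝ) ^ α -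
        x ^ (α + 1) * (4 / ((α + 1) * Real.log x ^ 2) + 8 / ((α + 1) ^ 2 * Real.log x ^ 3)) *
          (p ^ (-(2 * α) - 1) * Real.log p)| ≤
        D * (x ^ (α / 2 + 1) / Real.log x ^ 4) * (p ^ (-α - 1) * Real.log p) := by
  obtain ⟨C, hC, hT⟩ := exists_abs_sum_prime_rpow_sub_le hα
  refine ⟨128 / (α + 1) / α ^ 2 + 64 / (α + 1) ^ 2 / α + 128 * C, by positivity,
    fun x p hx hp hxp hlog h2 => ?_⟩
  have hx0 : 0 < x := by linarith
  have hp0 : 0 < p := by linarith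
  set L := Real.log x with hL
  have hL0 : 0 < L := Real.log_pos hx
  have hlp : 0 < Real.log p := Real.log_pos hp
  set v := Real.log p - L / 2 with hv
  have hv0 : 0 ≤ v := by
    have := Real.log_le_log (Real.sqrt_pos.mpr hx0) hxp
    rw [Real.log_sqrt hx0.le] at this
    linarith
  have hvp : Real.log p = L / 2 + v := by rw [hv]; ring
  have hvl : Real.log (x / p) = L / 2 - v := by
    rw [Real.log_div hx0.ne' hp0.ne', hv]; ring
  obtain ⟨b1, b2, b3⟩ := abs_one_div_mul_sub_le hL0 hv0 (by linarith)
  have hl0 : 0 < L / 2 - v := by linarith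
  have hm0 : 0 < L / 2 + v := by linarith
  set R := Real.exp (α * v) with hR
  have hR1 : 1 ≤ R := Real.one_le_exp (by positivity)
  have hvR : v ≤ R / α := by
    rw [le_div_iff₀ hα]
    linarith [Real.add_one_le_exp (α * v)]
  have hv2R : v ^ 2 ≤ 4 * R / α ^ 2 := by
    rw [le_div_iff₀ (by positivity)]
    have h3 := Real.add_one_le_exp (α * v / 2)
    have h4 : R = Real.exp (α * v / 2) ^ 2 := by
      rw [hR, ← Real.exp_nat_mul]; congr 1; push_cast; ring
    have h5 : 0 ≤ α * v / 2 := by positivity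
    rw [h4]
    nlinarith
  set Y := (x / p) ^ (α + 1) with hY
  have hY0 : 0 < Y := by positivity
  have hT' := hT (x / p) h2
  rw [hvl] at hT'
  set T := ∑ q ∈ (Icc 2 ⌊x / p⌋₊).filter Nat.Prime, (q : ℝ) ^ α
  have hW : x ^ (α + 1) * p ^ (-(2 * α) - 1) = p ^ (-α) * Y := by
    rw [hY, Real.div_rpow hx0.le hp0.le, mul_div_assoc', mul_comm (p ^ (-α)), mul_div_assoc,
      ← Real.rpow_sub hp0]
    congr 2; ring
  have hWR : p ^ (-α) * Y * R = x ^ (α / 2 + 1) * p ^ (-α - 1) := by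
    rw [← hW, hR, Real.rpow_def_of_pos hx0, Real.rpow_def_of_pos hp0, Real.rpow_def_of_pos hx0,
      Real.rpow_def_of_pos hp0, ← Real.exp_add, ← Real.exp_add, ← Real.exp_add, ← hL, hv]
    congr 1; ring
  have hc : |1 / (α + 1) * (1 / ((L / 2 - v) * (L / 2 + v)) - 4 / L ^ 2) +
      1 / (α + 1) ^ 2 * (1 / ((L / 2 - v) ^ 2 * (L / 2 + v)) - 8 / L ^ 3)| ≤
      (128 / (α + 1) / α ^ 2 + 64 / (α + 1) ^ 2 / α) * (R / L ^ 4) := by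
    refine (abs_add_le _ _).trans ?_
    rw [abs_mul, abs_mul, abs_of_nonneg (by positivity : 0 ≤ 1 / (α + 1)),
      abs_of_nonneg (by positivity : 0 ≤ 1 / (α + 1) ^ 2)]
    calc _ ≤ 1 / (α + 1) * (32 * (4 * R / α ^ 2) / L ^ 4) +
          1 / (α + 1) ^ 2 * (64 * (R / α) / L ^ 4) := by
          gcongr
          · exact b1.trans (by gcongr)
          · exact b2.trans (by gcongr)
      _ = _ := by field_simp; ring
  have hd : Real.log p * (C * (Y / (L / 2 - v) ^ 3)) ≤
      Real.log p ^ 2 * Y * (128 * C * (R / L ^ 4)) := by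
    calc _ = Real.log p ^ 2 * Y * (C * (1 / ((L / 2 - v) ^ 3 * (L / 2 + v)))) := by
          rw [hvp]; field_simp
      _ ≤ Real.log p ^ 2 * Y * (C * (128 / L ^ 4)) := by gcongr
      _ = Real.log p ^ 2 * Y * (128 * C * (1 / L ^ 4)) := by ring
      _ ≤ _ := by gcongr
  have hmain : |T - Y * (4 / ((α + 1) * L ^ 2) + 8 / ((α + 1) ^ 2 * L ^ 3)) * Real.log p| ≤
      (128 / (α + 1) / α ^ 2 + 64 / (α + 1) ^ 2 / α + 128 * C) * (R / L ^ 4) *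
        (Y * Real.log p) := by
    have e : T - Y * (4 / ((α + 1) * L ^ 2) + 8 / ((α + 1) ^ 2 * L ^ 3)) * Real.log p =
        (T - (Y / ((α + 1) * (L / 2 - v)) + Y / ((α + 1) ^ 2 * (L / 2 - v) ^ 2))) +
        (Y * Real.log p) * (1 / (α + 1) * (1 / ((L / 2 - v) * (L / 2 + v)) - 4 / L ^ 2) +
          1 / (α + 1) ^ 2 * (1 / ((L / 2 - v) ^ 2 * (L / 2 + v)) - 8 / L ^ 3)) := by
      rw [hvp]
      generalize L / 2 - v = l at hl0 ⊢
      generalize L / 2 + v = m at hm0 ⊢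
      field_simp
      ring
    rw [e]
    refine (abs_add_le _ _).trans ?_
    rw [abs_mul, abs_of_nonneg (by positivity : 0 ≤ Y * Real.log p)]
    have hd' : C * (Y / (L / 2 - v) ^ 3) ≤ (128 * C) * (R / L ^ 4) * (Y * Real.log p) := by
      refine le_of_mul_le_mul_left ?_ hlp
      linarith
    have := mul_le_mul_of_nonneg_left hc (by positivity : 0 ≤ Y * Real.log p)
    linarith
  have e : p ^ (-α) * T - x ^ (α + 1) * (4 / ((α + 1) * L ^ 2) + 8 / ((α + 1) ^ 2 * L ^ 3)) *
      (p ^ (-(2 * α) - 1) * Real.log p) = p ^ (-α) *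
        (T - Y * (4 / ((α + 1) * L ^ 2) + 8 / ((α + 1) ^ 2 * L ^ 3)) * Real.log p) := by
    linear_combination (-(4 / ((α + 1) * L ^ 2) + 8 / ((α + 1) ^ 2 * L ^ 3)) * Real.log p) * hW
  rw [e, abs_mul, abs_of_nonneg (by positivity)]
  refine (mul_le_mul_of_nonneg_left hmain (by positivity)).trans (le_of_eq ?_)
  linear_combination ((128 / (α + 1) / α ^ 2 + 64 / (α + 1) ^ 2 / α + 128 * C) / L ^ 4 *
    Real.log p) * hWR

/-- For `α > 0`,
`Σ_{√x < p ≤ √x (log x)^{4/α}} p^{-α} Σ_{q ≤ x/p} q^α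
  = (2/(α(α+1)))·x/log²x + (4/(α(α+1)²))·x/log³x + O(x/log⁴x)`,
the sums ranging over primes. -/
theorem I2_asymptotic (α : ℝ) (hα : 0 < α) :
    (fun x : ℝ =>
        (∑ p ∈ (Finset.Icc 2 ⌊Real.sqrt x * Real.log x ^ ((4:ℝ) / α)⌋₊).filter
            (fun p : ℕ => p.Prime ∧ Real.sqrt x < (p : ℝ)),
            (p : ℝ) ^ (-α) *
              ∑ q ∈ (Finset.Icc 2 ⌊x / (p : ℝ)⌋₊).filter Nat.Prime, (q : ℝ) ^ α)
        - ((2 / (α * (α + 1))) * (x / Real.log x ^ 2)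
          + (4 / (α * (α + 1) ^ 2)) * (x / Real.log x ^ 3)))
      =O[atTop] (fun x : ℝ => x / Real.log x ^ 4) := by
  obtain ⟨D, hD, hterm⟩ := exists_abs_rpow_mul_sum_sub_le hα
  obtain ⟨C₁, hC₁, hU⟩ := exists_abs_sum_log_mul_rpow_sub_le hα
  obtain ⟨C₂, hC₂, hV⟩ := exists_abs_sum_log_mul_rpow_sub_le (show 0 < 2 * α by linarith)
  have hloglog : ∀ᶠ x : ℝ in atTop, Real.log (Real.log x) ≤ α / 16 * Real.log x := by
    have h := Real.tendsto_log_atTop.eventually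
      (Real.isLittleO_log_id_atTop.bound (show 0 < α / 16 by positivity))
    filter_upwards [h, eventually_ge_atTop 1] with x hx hx1
    rw [id, Real.norm_eq_abs, Real.norm_eq_abs, abs_of_nonneg (Real.log_nonneg hx1)] at hx
    exact (le_abs_self _).trans hx
  refine Asymptotics.IsBigO.of_bound (D * (2 / α + 4 * C₁) +
    (4 / (α + 1) + 8 / (α + 1) ^ 2) * (1 / (2 * α) + 4 * C₂)) ?_
  filter_upwards [hloglog, eventually_ge_atTop 16] with x hll hx16
  have hx0 : 0 < x := by linarith
  set L := Real.log x with hL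
  have hl2 : 4 * Real.log 2 ≤ L := by
    have h := Real.log_le_log (by norm_num) hx16
    rw [show (16 : ℝ) = 2 ^ 4 by norm_num, Real.log_pow] at h
    exact_mod_cast h
  have hL1 : 1 ≤ L := by linarith [Real.log_two_gt_d9]
  have hL0 : 0 < L := by linarith
  have hz4 : 4 ≤ √x := Real.le_sqrt_of_sq_le (by linarith)
  have hz0 : 0 < √x := by linarith
  set P := √x * L ^ (4 / α) with hP
  have hzP : √x ≤ P := le_mul_of_one_le_right hz0.le (Real.one_le_rpow hL1 (by positivity))
  have hP0 : 0 < P := hz0.trans_le hzP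
  have hlz : Real.log √x = L / 2 := Real.log_sqrt hx0.le
  have hlP : Real.log P ≤ 3 / 4 * L := by
    rw [hP, Real.log_mul hz0.ne' (by positivity), hlz, Real.log_rpow hL0]
    have : 4 / α * Real.log L ≤ 4 / α * (α / 16 * L) := by gcongr
    have e : 4 / α * (α / 16 * L) = L / 4 := by field_simp; norm_num
    linarith
  have hF : (Icc 2 ⌊P⌋₊).filter (fun p : ℕ => p.Prime ∧ √x < (p : ℝ)) =
      (Ioc ⌊√x⌋₊ ⌊P⌋₊).filter Nat.Prime := by
    ext p
    simp only [Finset.mem_filter, Finset.mem_Icc, Finset.mem_Ioc, ← Nat.floor_lt hz0.le]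
    exact ⟨fun h => ⟨⟨h.2.2, h.1.2⟩, h.2.1⟩, fun h => ⟨⟨h.2.two_le, h.1.2⟩, h.2, h.1.1⟩⟩
  rw [hF]
  set F := (Ioc ⌊√x⌋₊ ⌊P⌋₊).filter Nat.Prime
  have hpF : ∀ p ∈ F, √x ≤ (p : ℝ) ∧ (p : ℝ) ≤ P := fun p hp => by
    have h := Finset.mem_Ioc.mp (Finset.mem_filter.mp hp).1
    exact ⟨((Nat.floor_lt hz0.le).mp h.1).le, (Nat.le_floor_iff hP0.le).mp h.2⟩
  set A := x ^ (α + 1) * (4 / ((α + 1) * L ^ 2) + 8 / ((α + 1) ^ 2 * L ^ 3)) with hA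
  have hA0 : 0 ≤ A := by positivity
  set S := ∑ p ∈ F, (p : ℝ) ^ (-α) * ∑ q ∈ (Icc 2 ⌊x / (p : ℝ)⌋₊).filter Nat.Prime, (q : ℝ) ^ α
  set U := ∑ p ∈ F, (p : ℝ) ^ (-α - 1) * Real.log p
  set V := ∑ p ∈ F, (p : ℝ) ^ (-(2 * α) - 1) * Real.log p
  have hSV : |S - A * V| ≤ D * (x ^ (α / 2 + 1) / L ^ 4) * U := by
    rw [Finset.mul_sum, Finset.mul_sum, ← Finset.sum_sub_distrib]
    refine (Finset.abs_sum_le_sum_abs _ _).trans (Finset.sum_le_sum fun p hp => ?_)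
    obtain ⟨h1, h2⟩ := hpF p hp
    have hp0 : (0 : ℝ) < p := by linarith
    have hlp : Real.log p ≤ 3 / 4 * L := (Real.log_le_log hp0 h2).trans hlP
    refine hterm x p (by linarith) (by linarith) h1 hlp ?_
    rw [← Real.log_le_log_iff (by norm_num) (by positivity), Real.log_div hx0.ne' hp0.ne']
    linarith
  have hzα : ∀ β : ℝ, √x ^ (-β) = x ^ (-(β / 2)) := fun β => by
    rw [Real.sqrt_eq_rpow, ← Real.rpow_mul hx0.le]; congr 1; ring
  have hU' := (abs_le.mp (hU √x P (by linarith) hzP)).2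
  have hV' := hV √x P (by linarith) hzP
  have hPα : P ^ (-α) ≤ √x ^ (-α) := Real.rpow_le_rpow_of_nonpos hz0 hzP (by linarith)
  have hP2α : P ^ (-(2 * α)) ≤ x ^ (-α) / L ^ 2 := by
    rw [hP, Real.mul_rpow hz0.le (by positivity), hzα, ← Real.rpow_mul hL0.le,
      show 4 / α * -(2 * α) = -8 by field_simp; norm_num, show -(2 * α / 2) = -α by ring,
      div_eq_mul_inv, ← Real.rpow_natCast, ← Real.rpow_neg hL0.le]
    gcongr
    norm_num
  have hUle : U ≤ (2 / α + 4 * C₁) * x ^ (-(α / 2)) := by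
    rw [hlz, hzα] at hU'
    rw [hzα] at hPα
    have h1 : x ^ (-(α / 2)) / (L / 2) ^ 2 ≤ 4 * x ^ (-(α / 2)) := by
      rw [div_le_iff₀ (by positivity)]
      nlinarith [Real.rpow_pos_of_pos hx0 (-(α / 2)), one_le_pow₀ hL1 (n := 2)]
    have h2 : P ^ (-α) / α ≤ x ^ (-(α / 2)) / α := by gcongr
    have h3 := mul_le_mul_of_nonneg_left h1 hC₁.le
    have e : (2 / α + 4 * C₁) * x ^ (-(α / 2)) =
      x ^ (-(α / 2)) / α + x ^ (-(α / 2)) / α + C₁ * (4 * x ^ (-(α / 2))) := by ring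
    linarith
  have hVle : |V - x ^ (-α) / (2 * α)| ≤ (1 / (2 * α) + 4 * C₂) * (x ^ (-α) / L ^ 2) := by
    rw [hlz, hzα, show 2 * α / 2 = α by ring] at hV'
    refine hV'.trans ?_
    calc _ ≤ x ^ (-α) / L ^ 2 / (2 * α) + C₂ * (x ^ (-α) / (L / 2) ^ 2) := by gcongr
      _ = _ := by field_simp; ring
  have hxα : x ^ (α + 1) * x ^ (-α) = x := by
    rw [← Real.rpow_add hx0]; norm_num
  have hxα2 : x ^ (α / 2 + 1) * x ^ (-(α / 2)) = x := by
    rw [← Real.rpow_add hx0]; norm_num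
  have hmain : A * (x ^ (-α) / (2 * α)) =
      2 / (α * (α + 1)) * (x / L ^ 2) + 4 / (α * (α + 1) ^ 2) * (x / L ^ 3) := by
    calc _ = x ^ (α + 1) * x ^ (-α) * (2 / (α * (α + 1)) * (1 / L ^ 2) +
          4 / (α * (α + 1) ^ 2) * (1 / L ^ 3)) := by
          rw [hA]; field_simp; ring
      _ = _ := by rw [hxα]; ring
  have hAle : A ≤ x ^ (α + 1) * ((4 / (α + 1) + 8 / (α + 1) ^ 2) / L ^ 2) := by
    have h1 : L ^ 2 ≤ L ^ 3 := pow_le_pow_right₀ hL1 (by norm_num)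
    calc A ≤ x ^ (α + 1) * (4 / ((α + 1) * L ^ 2) + 8 / ((α + 1) ^ 2 * L ^ 2)) := by
          rw [hA]; gcongr
      _ = _ := by field_simp
  have h1 : D * (x ^ (α / 2 + 1) / L ^ 4) * U ≤ D * (2 / α + 4 * C₁) * (x / L ^ 4) := by
    calc _ ≤ D * (x ^ (α / 2 + 1) / L ^ 4) * ((2 / α + 4 * C₁) * x ^ (-(α / 2))) := by gcongr
      _ = D * (2 / α + 4 * C₁) * (x ^ (α / 2 + 1) * x ^ (-(α / 2)) / L ^ 4) := by ring
      _ = _ := by rw [hxα2]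
  have h2 : |A * (V - x ^ (-α) / (2 * α))| ≤
      (4 / (α + 1) + 8 / (α + 1) ^ 2) * (1 / (2 * α) + 4 * C₂) * (x / L ^ 4) := by
    rw [abs_mul, abs_of_nonneg hA0]
    calc _ ≤ x ^ (α + 1) * ((4 / (α + 1) + 8 / (α + 1) ^ 2) / L ^ 2) *
          ((1 / (2 * α) + 4 * C₂) * (x ^ (-α) / L ^ 2)) := by gcongr
      _ = (4 / (α + 1) + 8 / (α + 1) ^ 2) * (1 / (2 * α) + 4 * C₂) *
          (x ^ (α + 1) * x ^ (-α) / L ^ 4) := by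
          generalize 4 / (α + 1) + 8 / (α + 1) ^ 2 = a
          generalize 1 / (2 * α) + 4 * C₂ = b
          field_simp
      _ = _ := by rw [hxα]
  have h3 : S - (2 / (α * (α + 1)) * (x / L ^ 2) + 4 / (α * (α + 1) ^ 2) * (x / L ^ 3)) =
      (S - A * V) + A * (V - x ^ (-α) / (2 * α)) := by
    rw [← hmain]; ring
  rw [h3, Real.norm_eq_abs, Real.norm_eq_abs, abs_of_nonneg (by positivity : 0 ≤ x / L ^ 4),
    add_mul]
  exact (abs_add_le _ _).trans (add_le_add (hSV.trans h1) h2)
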